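/- Assume that for every degree m ≤ n, every GC_m set possesses a maximal line (the GM conjecture up to degree n). Let X be a GC_n set and let ℓ be a k-node line of X with 2 ≤ k ≤ n+1 such that X_ℓ ≠ ∅. Then there exists an integer s with 2k − n − 1 ≤ s ≤ k such that |X_ℓ| = binomial(s,2) and, for every maximal line λ of X, the number of nodes of X_ℓ lying on λ equals either 0 or s − 1. -/

import Mathlib

open MvPolynomial

/-- Bivariate real polynomials. -/
abbrev Poly2 : Type := MvPolynomial (Fin 2) ℝ

/-- Evaluation of a bivariate polynomial at a point of `ℝ²`. -/
noncomputable def evalPt (p : Poly2) (A : ℝ × ℝ) : ℝ :=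
  MvPolynomial.eval (fun i => if i = 0 then A.1 else A.2) p

/-- `X` is an `n`-poised set: it has `(n+2 choose 2)` nodes and the only polynomial of
total degree at most `n` vanishing on all of `X` is the zero polynomial. -/
def IsPoised (n : ℕ) (X : Finset (ℝ × ℝ)) : Prop :=
  X.card = (n + 2).choose 2 ∧
    ∀ p : Poly2, p.totalDegree ≤ n → (∀ A ∈ X, evalPt p A = 0) → p = 0

/-- `p` is an `n`-fundamental polynomial of the node `A` with respect to `X`. -/
def IsFund (n : ℕ) (X : Finset (ℝ × ℝ)) (A : ℝ × ℝ) (p : Poly2) : Prop :=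
  p.totalDegree ≤ n ∧ evalPt p A = 1 ∧ ∀ B ∈ X, B ≠ A → evalPt p B = 0

/-- `X` is a `GC_n` set: `n`-poised and each node has a fundamental polynomial which is
a product of `n` polynomials of degree 1. -/
def IsGC (n : ℕ) (X : Finset (ℝ × ℝ)) : Prop :=
  IsPoised n X ∧
    ∀ A ∈ X, ∃ p : Poly2, IsFund n X A p ∧
      ∃ f : Fin n → Poly2, (∀ i, (f i).totalDegree = 1) ∧ p = ∏ i, f i

/-- The nodes of `X` lying on the zero set of `ℓ`. -/
noncomputable def nodesOn (X : Finset (ℝ × ℝ)) (ℓ : Poly2) : Finset (ℝ × ℝ) :=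
  @Finset.filter _ (fun A => evalPt ℓ A = 0) (Classical.decPred _) X

/-- `ℓ` is a `k`-node line of `X`: it has degree exactly 1 and passes through exactly
`k` nodes of `X`. -/
def IsKNodeLine (X : Finset (ℝ × ℝ)) (ℓ : Poly2) (k : ℕ) : Prop :=
  ℓ.totalDegree = 1 ∧ (nodesOn X ℓ).card = k

/-- A maximal line of an `n`-poised set: an `(n+1)`-node line. -/
def IsMaximalLine (n : ℕ) (X : Finset (ℝ × ℝ)) (ℓ : Poly2) : Prop :=
  IsKNodeLine X ℓ (n + 1)

/-- The zero set of a polynomial, i.e. the line it determines when it has degree 1. -/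
def zeroSet (ℓ : Poly2) : Set (ℝ × ℝ) := {A | evalPt ℓ A = 0}

/-- `μ(X)`: the number of maximal lines (as subsets of the plane) of `X`. -/
noncomputable def mu (n : ℕ) (X : Finset (ℝ × ℝ)) : ℕ :=
  {L : Set (ℝ × ℝ) | ∃ ℓ : Poly2, IsMaximalLine n X ℓ ∧ L = zeroSet ℓ}.ncard

/-- The node `A` of `X` uses the line `ℓ`: `ℓ` divides a fundamental polynomial of `A`. -/
def Uses (n : ℕ) (X : Finset (ℝ × ℝ)) (ℓ : Poly2) (A : ℝ × ℝ) : Prop :=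
  ∃ p : Poly2, IsFund n X A p ∧ ℓ ∣ p

/-- `X_ℓ`: the set of nodes of `X` using the line `ℓ`. -/
noncomputable def usesSet (n : ℕ) (X : Finset (ℝ × ℝ)) (ℓ : Poly2) : Finset (ℝ × ℝ) :=
  @Finset.filter _ (Uses n X ℓ) (Classical.decPred _) X

/-- The Gasca–Maeztu conjecture for degree `m`: every `GC_m` set has a maximal line. -/
def GM (m : ℕ) : Prop :=
  ∀ Y : Finset (ℝ × ℝ), IsGC m Y → ∃ lam : Poly2, IsMaximalLine m Y lam


/-! ### Lines and polynomials -/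

section evalLemmas
variable (p q : Poly2) (A : ℝ × ℝ)
theorem ev_mul : evalPt (p * q) A = evalPt p A * evalPt q A := by simp [evalPt]
theorem ev_add : evalPt (p + q) A = evalPt p A + evalPt q A := by simp [evalPt]
theorem ev_sub : evalPt (p - q) A = evalPt p A - evalPt q A := by simp [evalPt]
theorem ev_C (c : ℝ) : evalPt (C c) A = c := by simp [evalPt]
theorem ev_one : evalPt 1 A = 1 := by simp [evalPt]
theorem ev_zero : evalPt 0 A = 0 := by simp [evalPt]
theorem ev_sum {ι : Type*} (s : Finset ι) (f : ι → Poly2) :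
    evalPt (∑ i ∈ s, f i) A = ∑ i ∈ s, evalPt (f i) A := by simp [evalPt]
theorem ev_prod {ι : Type*} (s : Finset ι) (f : ι → Poly2) :
    evalPt (∏ i ∈ s, f i) A = ∏ i ∈ s, evalPt (f i) A := by
  simp [evalPt]
end evalLemmas

theorem ev_dvd {p q : Poly2} {A : ℝ × ℝ} (h : p ∣ q) (hp : evalPt p A = 0) : evalPt q A = 0 := by
  obtain ⟨r, rfl⟩ := h
  rw [ev_mul, hp, zero_mul]

/-- A polynomial of degree one. -/
abbrev Ln (a : Poly2) : Prop := a.totalDegree = 1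

noncomputable def cfa (a : Poly2) : ℝ := coeff (Finsupp.single 0 1) a
noncomputable def cfb (a : Poly2) : ℝ := coeff (Finsupp.single 1 1) a
noncomputable def cfk (a : Poly2) : ℝ := coeff 0 a

theorem fin2_deg_le_one (m : Fin 2 →₀ ℕ) (h : m.degree ≤ 1) :
    m = 0 ∨ m = Finsupp.single 0 1 ∨ m = Finsupp.single 1 1 := by
  have h1 : m 0 + m 1 ≤ 1 := by
    have : m.degree = m 0 + m 1 := by
      rw [Finsupp.degree_eq_sum]; simp
    omega
  have : (m 0 = 0 ∧ m 1 = 0) ∨ (m 0 = 1 ∧ m 1 = 0) ∨ (m 0 = 0 ∧ m 1 = 1) := by omega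
  rcases this with h | h | h
  · left; ext i; fin_cases i <;> simp [h.1, h.2]
  · right; left; ext i; fin_cases i <;> simp [h.1, h.2]
  · right; right; ext i; fin_cases i <;> simp [h.1, h.2]

theorem affine_form (a : Poly2) (h : a.totalDegree ≤ 1) :
    a = C (cfa a) * X 0 + C (cfb a) * X 1 + C (cfk a) := by
  ext m
  by_cases hm : m.degree ≤ 1
  · rcases fin2_deg_le_one m hm with rfl | rfl | rfl
    · simp [cfa, cfb, cfk, coeff_C_mul, coeff_X]
    · simp [cfa, cfb, cfk, coeff_C_mul, coeff_X, coeff_C, Finsupp.single_eq_single_iff, eq_comm (a := (0 : Fin 2 →₀ ℕ))]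
    · simp [cfa, cfb, cfk, coeff_C_mul, coeff_X, coeff_C, Finsupp.single_eq_single_iff, eq_comm (a := (0 : Fin 2 →₀ ℕ))]
  · have h1 : coeff m a = 0 := by
      apply coeff_eq_zero_of_totalDegree_lt
      have : ∑ i ∈ m.support, m i = m.degree := rfl
      omega
    have h2 : m ≠ 0 := by rintro rfl; simp at hm
    have h3 : ∀ i : Fin 2, Finsupp.single i 1 ≠ m := by rintro i rfl; simp at hm
    rw [h1]
    simp [coeff_C_mul, coeff_X, coeff_C, h2.symm, h3]

theorem ev_affine (a : Poly2) (h : a.totalDegree ≤ 1) (P : ℝ × ℝ) :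
    evalPt a P = cfa a * P.1 + cfb a * P.2 + cfk a := by
  conv_lhs => rw [affine_form a h]
  simp [evalPt]

noncomputable def nrm (a : Poly2) : ℝ := cfa a ^ 2 + cfb a ^ 2

theorem nrm_ne {a : Poly2} (h : Ln a) : nrm a ≠ 0 := by
  intro h0
  have h1 : cfa a = 0 := by unfold nrm at h0; nlinarith [sq_nonneg (cfa a), sq_nonneg (cfb a)]
  have h2 : cfb a = 0 := by unfold nrm at h0; nlinarith [sq_nonneg (cfa a), sq_nonneg (cfb a)]
  have h3 := affine_form a h.le
  rw [h1, h2] at h3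
  have : a.totalDegree = 0 := by rw [h3]; simp
  omega

/-- Parametrization of the line. -/
noncomputable def ptl (a : Poly2) (t : ℝ) : ℝ × ℝ :=
  (-(cfk a * cfa a / nrm a) + -(cfb a) * t, -(cfk a * cfb a / nrm a) + cfa a * t)

noncomputable def par (a : Poly2) (P : ℝ × ℝ) : ℝ := (-(cfb a) * P.1 + cfa a * P.2) / nrm a

theorem ev_ptl {a : Poly2} (h : Ln a) (t : ℝ) : evalPt a (ptl a t) = 0 := by
  rw [ev_affine a h.le]
  have := nrm_ne h
  simp only [ptl]
  field_simp
  unfold nrm; ring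

theorem ptl_par {a : Poly2} (h : Ln a) {P : ℝ × ℝ} (hP : evalPt a P = 0) : ptl a (par a P) = P := by
  rw [ev_affine a h.le] at hP
  have h0 := nrm_ne h
  have hc : cfk a = -(cfa a * P.1 + cfb a * P.2) := by linarith
  ext
  · simp only [ptl, par, hc]; field_simp; unfold nrm; ring
  · simp only [ptl, par, hc]; field_simp; unfold nrm; ring

theorem par_ptl {a : Poly2} (h : Ln a) (t : ℝ) : par a (ptl a t) = t := by
  have h0 := nrm_ne h
  simp only [ptl, par]; field_simp; unfold nrm; ring

/-- Restriction to a line. -/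
noncomputable def sg (a : Poly2) : Poly2 →ₐ[ℝ] Polynomial ℝ :=
  aeval (fun i : Fin 2 => if i = 0 then
      Polynomial.C (-(cfk a * cfa a / nrm a)) + Polynomial.C (-(cfb a)) * Polynomial.X
    else Polynomial.C (-(cfk a * cfb a / nrm a)) + Polynomial.C (cfa a) * Polynomial.X)

theorem sg_eval (a b : Poly2) (t : ℝ) : (sg a b).eval t = evalPt b (ptl a t) := by
  have : ((Polynomial.evalRingHom t).comp (sg a).toRingHom) =
      (MvPolynomial.eval (fun i => if i = 0 then (ptl a t).1 else (ptl a t).2)) := by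
    apply MvPolynomial.ringHom_ext
    · intro r; simp [sg]
    · intro i; fin_cases i <;> simp [sg, ptl]
  exact congrArg (fun f => f b) this

theorem sg_self {a : Poly2} (h : Ln a) : sg a a = 0 := by
  apply Polynomial.funext
  intro t
  rw [sg_eval, ev_ptl h]; simp

theorem sg_natDegree (a b : Poly2) : (sg a b).natDegree ≤ b.totalDegree := by
  have := MvPolynomial.aeval_natDegree_le (m := b.totalDegree) (n := 1) b le_rfl (fun i : Fin 2 => if i = 0 then
      Polynomial.C (-(cfk a * cfa a / nrm a)) + Polynomial.C (-(cfb a)) * Polynomial.X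
    else Polynomial.C (-(cfk a * cfb a / nrm a)) + Polynomial.C (cfa a) * Polynomial.X) ?_
  · simpa [sg] using this
  · intro i
    split_ifs <;> compute_degree

theorem sg_eq_zero {a b : Poly2} (h : Ln a) : sg a b = 0 ↔ a ∣ b := by
  constructor
  swap
  · rintro ⟨r, rfl⟩
    rw [map_mul, sg_self h, zero_mul]
  intro hb
  have h0 := nrm_ne h
  let u : Poly2 := C (-(cfb a) / nrm a) * X 0 + C (cfa a / nrm a) * X 1
  let τ : Polynomial ℝ →ₐ[ℝ] Poly2 := Polynomial.aeval u
  let mk := Ideal.Quotient.mkₐ ℝ (Ideal.span {a})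
  have key : mk = (mk.comp τ).comp (sg a) := by
    apply MvPolynomial.algHom_ext
    intro i
    have : a ∣ X i - τ (sg a (X i)) := by
      have ha := affine_form a h.le
      have hx : ∀ x : Fin 2 → ℝ, MvPolynomial.eval x a = cfa a * x 0 + cfb a * x 1 + cfk a := by
        intro x
        conv_lhs => rw [ha]
        simp
      fin_cases i
      · refine ⟨C (cfa a / nrm a), ?_⟩
        apply MvPolynomial.funext
        intro x
        simp only [sg, τ, u, aeval_X]
        simp [hx]
        field_simp
        unfold nrm; ring
      · refine ⟨C (cfb a / nrm a), ?_⟩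
        apply MvPolynomial.funext
        intro x
        simp only [sg, τ, u, aeval_X]
        simp [hx]
        field_simp
        unfold nrm; ring
    have h2 : mk (X i - τ (sg a (X i))) = 0 := by
      show Ideal.Quotient.mk _ _ = 0
      rw [Ideal.Quotient.eq_zero_iff_mem, Ideal.mem_span_singleton]; exact this
    rw [map_sub, sub_eq_zero] at h2
    exact h2
  have : mk b = 0 := by
    rw [key]; simp [hb]
  have h2 : Ideal.Quotient.mk (Ideal.span {a}) b = 0 := this
  rwa [Ideal.Quotient.eq_zero_iff_mem, Ideal.mem_span_singleton] at h2

theorem Ln.ne_zero {a : Poly2} (h : Ln a) : a ≠ 0 := by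
  rintro rfl; simp [Ln] at h

theorem Ln.prime {a : Poly2} (h : Ln a) : Prime a := by
  refine ⟨h.ne_zero, ?_, ?_⟩
  · intro hu
    have : sg a 1 = 0 := (sg_eq_zero h).2 hu.dvd
    simp at this
  · intro p q hpq
    rw [← sg_eq_zero h, map_mul, mul_eq_zero] at hpq
    rwa [← sg_eq_zero h, ← sg_eq_zero h]

theorem F1 {a b : Poly2} (ha : Ln a) {d : ℕ} (hb : b.totalDegree ≤ d) (S : Finset (ℝ × ℝ))
    (hSa : ∀ P ∈ S, evalPt a P = 0) (hSb : ∀ P ∈ S, evalPt b P = 0) (hc : d < S.card) : a ∣ b := by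
  rw [← sg_eq_zero ha]
  by_contra hne
  have hinj : Set.InjOn (par a) S := by
    intro P hP Q hQ hPQ
    rw [← ptl_par ha (hSa P hP), ← ptl_par ha (hSa Q hQ), hPQ]
  have hsub : (S.image (par a)) ⊆ (sg a b).roots.toFinset := by
    intro t ht
    rw [Finset.mem_image] at ht
    obtain ⟨P, hP, rfl⟩ := ht
    rw [Multiset.mem_toFinset, Polynomial.mem_roots hne, Polynomial.IsRoot, sg_eval,
      ptl_par ha (hSa P hP)]
    exact hSb P hP
  have h1 := Finset.card_le_card hsub
  rw [Finset.card_image_of_injOn hinj] at h1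
  have h2 := Multiset.toFinset_card_le (sg a b).roots
  have h3 := Polynomial.card_roots' (sg a b)
  have h4 := sg_natDegree a b
  omega

theorem two_pts {a b : Poly2} (ha : Ln a) (hb : b.totalDegree ≤ 1) {P Q : ℝ × ℝ} (hne : P ≠ Q)
    (h1 : evalPt a P = 0) (h2 : evalPt a Q = 0) (h3 : evalPt b P = 0) (h4 : evalPt b Q = 0) :
    a ∣ b := by
  apply F1 ha hb {P, Q}
  · simp [h1, h2]
  · simp [h3, h4]
  · rw [Finset.card_pair hne]; norm_num

theorem deg_mul_line {a g : Poly2} (ha : Ln a) (hg : g ≠ 0) :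
    (a * g).totalDegree = g.totalDegree + 1 := by
  rw [totalDegree_mul_of_isDomain ha.ne_zero hg, ha, add_comm]

theorem deg_of_mul {a g : Poly2} (ha : Ln a) {d : ℕ} (h : (a * g).totalDegree ≤ d + 1) :
    g.totalDegree ≤ d := by
  by_cases hg : g = 0
  · simp [hg]
  · rw [deg_mul_line ha hg] at h; omega

theorem deg_mul_le {a g : Poly2} (ha : Ln a) {d : ℕ} (h : g.totalDegree ≤ d) :
    (a * g).totalDegree ≤ d + 1 := by
  have := totalDegree_mul a g
  rw [ha] at this; omega

theorem dvd_line {a b : Poly2} (ha : Ln a) (hb : Ln b) (h : a ∣ b) : ∃ k : ℝ, k ≠ 0 ∧ b = C k * a := by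
  obtain ⟨g, rfl⟩ := h
  have : g.totalDegree = 0 := by
    have := deg_of_mul ha (d := 0) (g := g) (by rw [hb])
    omega
  rw [totalDegree_eq_zero_iff_eq_C] at this
  refine ⟨coeff 0 g, ?_, by rw [← this, mul_comm]⟩
  intro h0
  rw [h0] at this
  apply hb.ne_zero
  rw [this]; simp

theorem dvd_symm_line {a b : Poly2} (ha : Ln a) (hb : Ln b) (h : a ∣ b) : b ∣ a := by
  obtain ⟨k, hk, rfl⟩ := dvd_line ha hb h
  exact ⟨C k⁻¹, by rw [mul_comm (C k), mul_assoc, ← C_mul, mul_inv_cancel₀ hk]; simp⟩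

theorem ev_iff_of_dvd {a b : Poly2} (ha : Ln a) (hb : Ln b) (h : a ∣ b) (P : ℝ × ℝ) :
    evalPt a P = 0 ↔ evalPt b P = 0 :=
  ⟨fun h1 => ev_dvd h h1, fun h1 => ev_dvd (dvd_symm_line ha hb h) h1⟩

theorem line_eq_pt {a b : Poly2} (ha : Ln a) (hb : Ln b) (hab : ¬ a ∣ b) {P Q : ℝ × ℝ}
    (h1 : evalPt a P = 0) (h2 : evalPt a Q = 0) (h3 : evalPt b P = 0) (h4 : evalPt b Q = 0) :
    P = Q := by
  by_contra h
  exact hab (two_pts ha hb.le h h1 h2 h3 h4)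

/-- a line through `P` avoiding `Q`. -/
theorem exists_line_sep {P Q : ℝ × ℝ} (h : P ≠ Q) : ∃ L : Poly2, L.totalDegree ≤ 1 ∧ evalPt L P = 0 ∧
    evalPt L Q ≠ 0 := by
  by_cases h1 : P.1 = Q.1
  · have h2 : P.2 ≠ Q.2 := fun h2 => h (Prod.ext h1 h2)
    refine ⟨X 1 - C P.2, ?_, ?_, ?_⟩
    · refine (totalDegree_sub _ _).trans ?_
      simp
    · simp [evalPt]
    · simp [evalPt, sub_eq_zero, h2.symm]
  · refine ⟨X 0 - C P.1, ?_, ?_, ?_⟩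
    · refine (totalDegree_sub _ _).trans ?_
      simp
    · simp [evalPt]
    · simp [evalPt, sub_eq_zero, Ne.symm h1]


/-! ### Fundamental polynomials, removal of a line -/

/-- remove from `X` the zero set of `p` -/
noncomputable def rem (X : Finset (ℝ × ℝ)) (p : Poly2) : Finset (ℝ × ℝ) :=
  @Finset.filter _ (fun A => evalPt p A ≠ 0) (Classical.decPred _) X

theorem mem_rem {X : Finset (ℝ × ℝ)} {p : Poly2} {A : ℝ × ℝ} :
    A ∈ rem X p ↔ A ∈ X ∧ evalPt p A ≠ 0 := by
  simp [rem]

theorem mem_on {X : Finset (ℝ × ℝ)} {p : Poly2} {A : ℝ × ℝ} :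
    A ∈ nodesOn X p ↔ A ∈ X ∧ evalPt p A = 0 := by
  simp [nodesOn]

theorem rem_rem (X : Finset (ℝ × ℝ)) (p q : Poly2) : rem (rem X p) q = rem X (p * q) := by
  ext A; simp only [mem_rem, ev_mul]; rw [mul_ne_zero_iff]; tauto

theorem rem_comm (X : Finset (ℝ × ℝ)) (p q : Poly2) : rem (rem X p) q = rem (rem X q) p := by
  rw [rem_rem, rem_rem, mul_comm]

theorem card_rem (X : Finset (ℝ × ℝ)) (p : Poly2) :
    (nodesOn X p).card + (rem X p).card = X.card := by
  classical
  rw [← Finset.card_filter_add_card_filter_not (s := X) (fun A => evalPt p A = 0)]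
  have h1 : nodesOn X p = X.filter (fun A => evalPt p A = 0) := by ext A; simp [mem_on]
  have h2 : rem X p = X.filter (fun A => ¬ evalPt p A = 0) := by ext A; simp [mem_rem]
  rw [h1, h2]

theorem rem_sub (X : Finset (ℝ × ℝ)) (p : Poly2) : rem X p ⊆ X := fun _ h => (mem_rem.1 h).1

open Classical in
/-- the fundamental polynomial -/
noncomputable def fd (n : ℕ) (X : Finset (ℝ × ℝ)) (A : ℝ × ℝ) : Poly2 :=
  if h : ∃ p, IsFund n X A p then h.choose else 0

theorem fund_unique {n : ℕ} {X : Finset (ℝ × ℝ)} (hX : IsPoised n X) {A : ℝ × ℝ}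
    {p q : Poly2} (hp : IsFund n X A p) (hq : IsFund n X A q) : p = q := by
  rw [← sub_eq_zero]
  apply hX.2
  · exact (totalDegree_sub _ _).trans (max_le hp.1 hq.1)
  · intro B hB
    rw [ev_sub]
    by_cases h : B = A
    · subst h; rw [hp.2.1, hq.2.1, sub_self]
    · rw [hp.2.2 B hB h, hq.2.2 B hB h, sub_self]

section
variable {n : ℕ} {X : Finset (ℝ × ℝ)} {A : ℝ × ℝ}

theorem fd_spec (hX : IsGC n X) (hA : A ∈ X) : IsFund n X A (fd n X A) := by
  have h : ∃ p, IsFund n X A p := by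
    obtain ⟨p, hp, _⟩ := hX.2 A hA; exact ⟨p, hp⟩
  unfold fd
  rw [dif_pos h]; exact h.choose_spec

theorem fd_eq (hX : IsGC n X) (hA : A ∈ X) {p : Poly2} (hp : IsFund n X A p) : fd n X A = p :=
  fund_unique hX.1 (fd_spec hX hA) hp

theorem fd_deg (hX : IsGC n X) (hA : A ∈ X) : (fd n X A).totalDegree ≤ n := (fd_spec hX hA).1
theorem fd_self (hX : IsGC n X) (hA : A ∈ X) : evalPt (fd n X A) A = 1 := (fd_spec hX hA).2.1
theorem fd_other (hX : IsGC n X) (hA : A ∈ X) {B : ℝ × ℝ} (hB : B ∈ X) (h : B ≠ A) :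
    evalPt (fd n X A) B = 0 := (fd_spec hX hA).2.2 B hB h
theorem fd_ne (hX : IsGC n X) (hA : A ∈ X) : fd n X A ≠ 0 := by
  intro h; have := fd_self hX hA; rw [h, ev_zero] at this; norm_num at this
theorem fd_prod (hX : IsGC n X) (hA : A ∈ X) :
    ∃ f : Fin n → Poly2, (∀ i, Ln (f i)) ∧ fd n X A = ∏ i, f i := by
  obtain ⟨p, hp, f, hf, rfl⟩ := hX.2 A hA
  exact ⟨f, hf, fd_eq hX hA hp⟩

theorem fd_line_ne (hX : IsGC n X) (hA : A ∈ X) {ℓ : Poly2} (h : ℓ ∣ fd n X A) : evalPt ℓ A ≠ 0 := by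
  intro h0
  have := fd_self hX hA
  rw [ev_dvd h h0] at this; norm_num at this

theorem mem_uses (hX : IsGC n X) {ℓ : Poly2} : A ∈ usesSet n X ℓ ↔ A ∈ X ∧ ℓ ∣ fd n X A := by
  simp only [usesSet, Finset.mem_filter]
  constructor
  · rintro ⟨hA, p, hp, hd⟩
    rw [fd_eq hX hA hp]; exact ⟨hA, hd⟩
  · rintro ⟨hA, hd⟩
    exact ⟨hA, _, fd_spec hX hA, hd⟩

theorem lagrange (hX : IsGC n X) {q : Poly2} (hq : q.totalDegree ≤ n) :
    q = ∑ D ∈ X, C (evalPt q D) * fd n X D := by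
  classical
  rw [← sub_eq_zero]
  apply hX.1.2
  · refine (totalDegree_sub _ _).trans (max_le hq ?_)
    refine (totalDegree_finsetSum_le (d := n) ?_)
    intro D hD
    refine (totalDegree_mul _ _).trans ?_
    rw [totalDegree_C, zero_add]; exact fd_deg hX hD
  · intro B hB
    rw [ev_sub, ev_sum, Finset.sum_eq_single B]
    · rw [ev_mul, ev_C, fd_self hX hB, mul_one, sub_self]
    · intro D hD hne
      rw [ev_mul, fd_other hX hD hB hne.symm, mul_zero]
    · intro h; exact absurd hB h

theorem fd_line_through (hX : IsGC n X) (hA : A ∈ X) {P : ℝ × ℝ} (h : evalPt (fd n X A) P = 0) :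
    ∃ ℓ, Ln ℓ ∧ ℓ ∣ fd n X A ∧ evalPt ℓ P = 0 := by
  obtain ⟨f, hf, he⟩ := fd_prod hX hA
  rw [he, ev_prod, Finset.prod_eq_zero_iff] at h
  obtain ⟨i, _, hi⟩ := h
  exact ⟨f i, hf i, he ▸ Finset.dvd_prod_of_mem f (Finset.mem_univ i), hi⟩

theorem line_bound (hX : IsGC n X) {ℓ : Poly2} (hl : Ln ℓ) : (nodesOn X ℓ).card ≤ n + 1 := by
  classical
  by_contra h
  push Not at h
  obtain ⟨A, hA⟩ : (nodesOn X ℓ).Nonempty := by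
    rw [← Finset.card_pos]; omega
  have hA' := mem_on.1 hA
  have : ℓ ∣ fd n X A := by
    apply F1 hl (fd_deg hX hA'.1) ((nodesOn X ℓ).erase A)
    · intro P hP; exact (mem_on.1 (Finset.mem_of_mem_erase hP)).2
    · intro P hP
      exact fd_other hX hA'.1 (mem_on.1 (Finset.mem_of_mem_erase hP)).1 (Finset.ne_of_mem_erase hP)
    · rw [Finset.card_erase_of_mem hA]; omega
  exact fd_line_ne hX hA'.1 this hA'.2

end

abbrev Mx (n : ℕ) (X : Finset (ℝ × ℝ)) (a : Poly2) : Prop := IsMaximalLine n X a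

theorem IsMaximalLine.ln {n : ℕ} {X : Finset (ℝ × ℝ)} {a : Poly2} (h : IsMaximalLine n X a) : Ln a := h.1

theorem on_dvd {a b : Poly2} (ha : Ln a) (hb : Ln b) (h : a ∣ b) (X : Finset (ℝ × ℝ)) :
    nodesOn X a = nodesOn X b := by
  ext A; rw [mem_on, mem_on, ev_iff_of_dvd ha hb h]

theorem rem_dvd {a b : Poly2} (ha : Ln a) (hb : Ln b) (h : a ∣ b) (X : Finset (ℝ × ℝ)) :
    rem X a = rem X b := by
  ext A; rw [mem_rem, mem_rem, ne_eq, ev_iff_of_dvd ha hb h]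

theorem Mx_dvd {n : ℕ} {X : Finset (ℝ × ℝ)} {a b : Poly2} (ha : Mx n X a) (hb : Ln b) (h : a ∣ b) :
    Mx n X b := ⟨hb, by rw [← on_dvd ha.1 hb h]; exact ha.2⟩

section
variable {n : ℕ} {X : Finset (ℝ × ℝ)} {A : ℝ × ℝ}

theorem mx_dvd_fd (hX : IsGC n X) {a : Poly2} (ha : Mx n X a) (hA : A ∈ X) (h : evalPt a A ≠ 0) :
    a ∣ fd n X A := by
  apply F1 ha.1 (fd_deg hX hA) (nodesOn X a)
  · intro P hP; exact (mem_on.1 hP).2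
  · intro P hP
    refine fd_other hX hA (mem_on.1 hP).1 ?_
    rintro rfl; exact h (mem_on.1 hP).2
  · rw [ha.2]; omega

theorem scale_prod {n : ℕ} (f : Fin n → Poly2) (hf : ∀ i, Ln (f i)) (c : ℝ) (hc : c ≠ 0)
    (h0 : n = 0 → c = 1) : ∃ f' : Fin n → Poly2, (∀ i, Ln (f' i)) ∧ ∏ i, f' i = C c * ∏ i, f i := by
  cases n with
  | zero => exact ⟨f, hf, by simp [h0 rfl]⟩
  | succ m =>
    refine ⟨Fin.cons (C c * f 0) (fun i => f i.succ), ?_, ?_⟩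
    · intro i
      refine Fin.cases ?_ ?_ i
      · simp only [Fin.cons_zero]
        rw [Ln, totalDegree_mul_of_isDomain (by simpa using hc) (hf 0).ne_zero, totalDegree_C, hf 0]
      · intro j; simp only [Fin.cons_succ]; exact hf _
    · rw [Fin.prod_univ_succ, Fin.prod_univ_succ]; simp [mul_assoc]

theorem rem_poised (hX : IsGC (n+1) X) {a : Poly2} (ha : Mx (n+1) X a) : IsPoised n (rem X a) := by
  constructor
  · have h1 := card_rem X a
    rw [ha.2, hX.1.1, Nat.choose_succ_succ' (n+2) 1, Nat.choose_one_right] at h1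
    have : (n+1+1+1 : ℕ) = n + 1 + 2 := rfl
    simp only [Nat.reduceAdd] at *
    omega
  · intro p hp h
    have : a * p = 0 := by
      apply hX.1.2
      · exact deg_mul_le ha.1 hp
      · intro B hB
        rw [ev_mul]
        by_cases h' : evalPt a B = 0
        · rw [h', zero_mul]
        · rw [h B (mem_rem.2 ⟨hB, h'⟩), mul_zero]
    exact (mul_eq_zero.1 this).resolve_left (Ln.ne_zero ha.1)

theorem rem_GC (hX : IsGC (n+1) X) {a : Poly2} (ha : Mx (n+1) X a) : IsGC n (rem X a) := by
  refine ⟨rem_poised hX ha, ?_⟩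
  intro A hA
  obtain ⟨hAX, hAa⟩ := mem_rem.1 hA
  have hd := mx_dvd_fd hX ha hAX hAa
  obtain ⟨f, hf, he⟩ := fd_prod hX hAX
  rw [he] at hd
  obtain ⟨i, _, hi⟩ := ((Ln.prime ha.1).dvd_finsetProd_iff f).1 hd
  obtain ⟨k, hk, hki⟩ := dvd_line ha.1 (hf i) hi
  rw [Fin.prod_univ_succAbove f i, hki] at he
  set g := ∏ j, f (i.succAbove j) with hg
  have hself := fd_self hX hAX
  rw [he, ev_mul, ev_mul, ev_C] at hself
  have hgA : evalPt g A ≠ 0 := by intro h; rw [h, mul_zero] at hself; norm_num at hself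
  obtain ⟨f', hf', hp'⟩ := scale_prod (fun j => f (i.succAbove j)) (fun j => hf _) (evalPt g A)⁻¹
    (inv_ne_zero hgA) (by rintro rfl; simp [hg, ev_one])
  refine ⟨C (evalPt g A)⁻¹ * g, ⟨?_, ?_, ?_⟩, f', hf', hp'.symm⟩
  · refine (totalDegree_mul _ _).trans ?_
    rw [totalDegree_C, zero_add, hg]
    refine (totalDegree_finsetProd _ _).trans ?_
    rw [Finset.sum_congr rfl (fun j _ => hf _)]; simp
  · rw [ev_mul, ev_C, inv_mul_cancel₀ hgA]
  · intro B hB hne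
    obtain ⟨hBX, hBa⟩ := mem_rem.1 hB
    have := fd_other hX hAX hBX hne
    rw [he, ev_mul, ev_mul, ev_C] at this
    rw [ev_mul, (mul_eq_zero.1 this).resolve_left (mul_ne_zero hk hBa), mul_zero]

theorem fd_rem (hX : IsGC (n+1) X) {a : Poly2} (ha : Mx (n+1) X a) (hA : A ∈ rem X a) :
    fd (n+1) X A = C (evalPt a A)⁻¹ * (a * fd n (rem X a) A) := by
  obtain ⟨hAX, hAa⟩ := mem_rem.1 hA
  have hR := rem_GC hX ha
  apply fd_eq hX hAX
  refine ⟨?_, ?_, ?_⟩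
  · refine (totalDegree_mul _ _).trans ?_
    rw [totalDegree_C, zero_add]; exact deg_mul_le ha.1 (fd_deg hR hA)
  · rw [ev_mul, ev_C, ev_mul, fd_self hR hA, mul_one, inv_mul_cancel₀ hAa]
  · intro B hB hne
    rw [ev_mul, ev_mul]
    by_cases h : evalPt a B = 0
    · rw [h]; ring
    · rw [fd_other hR hA (mem_rem.2 ⟨hB, h⟩) hne]; ring

theorem C_dvd {p q : Poly2} {c : ℝ} (hc : c ≠ 0) : p ∣ C c * q ↔ p ∣ q := by
  have : IsUnit (C c : Poly2) := (isUnit_iff_ne_zero.2 hc).map C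
  exact this.dvd_mul_left

theorem dvd_fd_rem (hX : IsGC (n+1) X) {a : Poly2} (ha : Mx (n+1) X a) (hA : A ∈ rem X a) {ℓ : Poly2}
    (hl : Ln ℓ) (hal : ¬ ℓ ∣ a) : ℓ ∣ fd (n+1) X A ↔ ℓ ∣ fd n (rem X a) A := by
  rw [fd_rem hX ha hA, C_dvd (inv_ne_zero (mem_rem.1 hA).2), hl.prime.dvd_mul]
  tauto

theorem fd_rem_dvd (hX : IsGC (n+1) X) {a : Poly2} (ha : Mx (n+1) X a) (hA : A ∈ rem X a) :
    a * fd n (rem X a) A ∣ fd (n+1) X A := by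
  rw [fd_rem hX ha hA]; exact Dvd.intro_left _ rfl

/-! matching -/
theorem M1 {μ ℓ g : Poly2} (hμ : Ln μ) (hl : Ln ℓ) {S : Finset (ℝ × ℝ)} (hc : n ≤ S.card)
    (hS : ∀ P ∈ S, evalPt μ P = 0) (hd : (ℓ * g).totalDegree ≤ n) (hp : ∀ P ∈ S, evalPt (ℓ * g) P = 0)
    (hn : ¬ μ ∣ ℓ * g) : ∃ P ∈ S, evalPt ℓ P = 0 := by
  by_contra h
  push Not at h
  have hg : g ≠ 0 := by rintro rfl; simp at hn
  have hd' := deg_mul_line hl hg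
  apply hn
  apply Dvd.dvd.mul_left
  apply F1 hμ (d := n - 1) (by omega) S hS
  · intro P hP
    have := hp P hP
    rw [ev_mul] at this
    exact (mul_eq_zero.1 this).resolve_left (h P hP)
  · omega

theorem M2 {μ ℓ g : Poly2} (hμ : Ln μ) (hl : Ln ℓ) {S : Finset (ℝ × ℝ)} (hc : n ≤ S.card)
    (hS : ∀ P ∈ S, evalPt μ P = 0) (hd : (ℓ * g).totalDegree ≤ n) (hp : ∀ P ∈ S, evalPt (ℓ * g) P = 0)
    (hn : ¬ μ ∣ ℓ * g) {P : ℝ × ℝ} (hP : P ∈ S) (hPl : evalPt ℓ P = 0) : evalPt g P ≠ 0 := by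
  intro h0
  have hg : g ≠ 0 := by rintro rfl; simp at hn
  have hd' := deg_mul_line hl hg
  have hml : ¬ μ ∣ ℓ := fun h => hn (h.mul_right g)
  apply hn
  apply Dvd.dvd.mul_left
  apply F1 hμ (d := n - 1) (by omega) S hS
  · intro Q hQ
    by_cases hQP : Q = P
    · rw [hQP]; exact h0
    have := hp Q hQ
    rw [ev_mul] at this
    refine (mul_eq_zero.1 this).resolve_left fun h => hQP ?_
    exact line_eq_pt hμ hl hml (hS Q hQ) (hS P hP) h hPl
  · omega

theorem M1x (hX : IsGC n X) {a : Poly2} (ha : Mx n X a) (hA : A ∈ X) (hAa : evalPt a A = 0)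
    {ℓ : Poly2} (hl : Ln ℓ) (hd : ℓ ∣ fd n X A) : ∃ P ∈ X, evalPt a P = 0 ∧ P ≠ A ∧ evalPt ℓ P = 0 := by
  classical
  obtain ⟨g, hg⟩ := hd
  obtain ⟨P, hP, h⟩ := M1 (n := n) (g := g) ha.1 hl (S := (nodesOn X a).erase A)
    (by rw [Finset.card_erase_of_mem (mem_on.2 ⟨hA, hAa⟩), ha.2]; simp)
    (fun P hP => (mem_on.1 (Finset.mem_of_mem_erase hP)).2)
    (by rw [← hg]; exact fd_deg hX hA)
    (fun P hP => by
      rw [← hg]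
      exact fd_other hX hA (mem_on.1 (Finset.mem_of_mem_erase hP)).1 (Finset.ne_of_mem_erase hP))
    (by rw [← hg]; intro h; exact fd_line_ne hX hA h hAa)
  have h2 := mem_on.1 (Finset.mem_of_mem_erase hP)
  exact ⟨P, h2.1, h2.2, Finset.ne_of_mem_erase hP, h⟩

theorem M2x (hX : IsGC n X) {a : Poly2} (ha : Mx n X a) (hA : A ∈ X) (hAa : evalPt a A = 0)
    {ℓ g : Poly2} (hl : Ln ℓ) (hg : fd n X A = ℓ * g) {P : ℝ × ℝ} (hP : P ∈ X) (hPa : evalPt a P = 0)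
    (hPl : evalPt ℓ P = 0) : evalPt g P ≠ 0 := by
  classical
  refine M2 (n := n) (g := g) ha.1 hl (S := (nodesOn X a).erase A)
    (by rw [Finset.card_erase_of_mem (mem_on.2 ⟨hA, hAa⟩), ha.2]; simp)
    (fun P hP => (mem_on.1 (Finset.mem_of_mem_erase hP)).2)
    (by rw [← hg]; exact fd_deg hX hA)
    (fun P hP => by
      rw [← hg]
      exact fd_other hX hA (mem_on.1 (Finset.mem_of_mem_erase hP)).1 (Finset.ne_of_mem_erase hP))
    (by rw [← hg]; intro h; exact fd_line_ne hX hA h hAa) (P := P) ?_ hPl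
  rw [Finset.mem_erase, mem_on]
  refine ⟨?_, hP, hPa⟩
  rintro rfl
  exact fd_line_ne hX hA ⟨g, hg⟩ hPl

/-- no node of `X` on both lines -/
def Dj (X : Finset (ℝ × ℝ)) (a b : Poly2) : Prop := ∀ P ∈ X, evalPt a P = 0 → evalPt b P ≠ 0

theorem Dj.symm {a b : Poly2} (h : Dj X a b) : Dj X b a := fun P hP h1 h2 => h P hP h2 h1
theorem Dj.sub {a b : Poly2} (h : Dj X a b) {Y : Finset (ℝ × ℝ)} (hY : Y ⊆ X) : Dj Y a b :=
  fun P hP => h P (hY hP)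

theorem LD (hX : IsGC (n+1) X) {a v : Poly2} (ha : Mx (n+1) X a) (hv : Mx n (rem X a) v)
    (hav : Dj X a v) (hA : A ∈ X) (hAa : evalPt a A = 0) : ¬ v ∣ fd (n+1) X A := by
  classical
  rintro ⟨g, hg⟩
  have hd : a ∣ g := by
    apply F1 ha.1 (d := n) (deg_of_mul hv.1 (by rw [← hg]; exact fd_deg hX hA)) ((nodesOn X a).erase A)
    · exact (fun P hP => (mem_on.1 (Finset.mem_of_mem_erase hP)).2)
    · intro P hP
      have h1 := mem_on.1 (Finset.mem_of_mem_erase hP)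
      have := fd_other hX hA h1.1 (Finset.ne_of_mem_erase hP)
      rw [hg, ev_mul] at this
      exact (mul_eq_zero.1 this).resolve_left (hav P h1.1 h1.2)
    · rw [Finset.card_erase_of_mem (mem_on.2 ⟨hA, hAa⟩), ha.2]; simp
  exact fd_line_ne hX hA (hg ▸ hd.mul_left v) hAa

theorem D1 (hX : IsGC (n+1) X) {a v : Poly2} (ha : Mx (n+1) X a) (hv : Mx n (rem X a) v)
    (hav : Dj X a v) (hA : A ∈ X) (hAa : evalPt a A = 0) {ℓ : Poly2} (hl : Ln ℓ)
    (hd : ℓ ∣ fd (n+1) X A) : ∃ P ∈ rem X a, evalPt v P = 0 ∧ evalPt ℓ P = 0 := by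
  obtain ⟨g, hg⟩ := hd
  obtain ⟨P, hP, h⟩ := M1 (n := n+1) (g := g) hv.1 hl (S := (nodesOn (rem X a) v))
    hv.2.ge (fun P hP => (mem_on.1 hP).2)
    (by rw [← hg]; exact fd_deg hX hA)
    (fun P hP => by
      rw [← hg]
      refine fd_other hX hA (mem_rem.1 (mem_on.1 hP).1).1 ?_
      rintro rfl; exact (mem_rem.1 (mem_on.1 hP).1).2 hAa)
    (by rw [← hg]; exact LD hX ha hv hav hA hAa)
  exact ⟨P, (mem_on.1 hP).1, (mem_on.1 hP).2, h⟩

theorem D2 (hX : IsGC (n+1) X) {a v : Poly2} (ha : Mx (n+1) X a) (hv : Mx n (rem X a) v)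
    (hav : Dj X a v) (hA : A ∈ X) (hAa : evalPt a A = 0) {ℓ g : Poly2} (hl : Ln ℓ)
    (hg : fd (n+1) X A = ℓ * g) {P : ℝ × ℝ} (hP : P ∈ rem X a) (hPv : evalPt v P = 0)
    (hPl : evalPt ℓ P = 0) : evalPt g P ≠ 0 := by
  refine M2 (n := n+1) (g := g) hv.1 hl (S := (nodesOn (rem X a) v))
    hv.2.ge (fun P hP => (mem_on.1 hP).2)
    (by rw [← hg]; exact fd_deg hX hA)
    (fun P hP => by
      rw [← hg]
      refine fd_other hX hA (mem_rem.1 (mem_on.1 hP).1).1 ?_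
      rintro rfl; exact (mem_rem.1 (mem_on.1 hP).1).2 hAa)
    (by rw [← hg]; exact LD hX ha hv hav hA hAa) (mem_on.2 ⟨hP, hPv⟩) hPl

/-! basic facts on maximal lines -/
theorem P6 (hX : IsGC (n+1) X) {a b : Poly2} (ha : Mx (n+1) X a) (hb : Mx (n+1) X b) (hab : ¬ a ∣ b) :
    Mx n (rem X a) b := by
  classical
  refine ⟨hb.1, le_antisymm (line_bound (rem_GC hX ha) hb.1) ?_⟩
  have h1 : (nodesOn (nodesOn X b) a).card ≤ 1 := by
    rw [Finset.card_le_one]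
    intro P hP Q hQ
    simp only [mem_on] at hP hQ
    exact line_eq_pt ha.1 hb.1 hab hP.2 hQ.2 hP.1.2 hQ.1.2
  have h2 := card_rem (nodesOn X b) a
  rw [hb.2] at h2
  have h3 : rem (nodesOn X b) a = nodesOn (rem X a) b := by
    ext P; simp only [mem_rem, mem_on]; tauto
  rw [h3] at h2
  omega

theorem P7 (hX : IsGC (n+1) X) {a b : Poly2} (hb : Mx n (rem X a) b) :
    Mx (n+1) X b ∨ Dj X a b := by
  classical
  by_cases h : Dj X a b
  · exact Or.inr h
  left
  unfold Dj at h
  push Not at h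
  obtain ⟨P, hP, hPa, hPb⟩ := h
  refine ⟨hb.1, le_antisymm (line_bound hX hb.1) ?_⟩
  have : insert P (nodesOn (rem X a) b) ⊆ nodesOn X b := by
    intro Q hQ
    rw [Finset.mem_insert] at hQ
    rcases hQ with rfl | hQ
    · exact mem_on.2 ⟨hP, hPb⟩
    · exact mem_on.2 ⟨rem_sub _ _ (mem_on.1 hQ).1, (mem_on.1 hQ).2⟩
  have := Finset.card_le_card this
  rw [Finset.card_insert_of_notMem, hb.2] at this
  · omega
  · intro h; exact (mem_rem.1 (mem_on.1 h).1).2 hPa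

/-- a maximal line of the remainder is not proportional to the removed one -/
theorem not_dvd_rem {a b : Poly2} (ha : Ln a) (hb : Mx n (rem X a) b) : ¬ a ∣ b := by
  intro h
  have : (nodesOn (rem X a) b).card = 0 := by
    rw [Finset.card_eq_zero, Finset.eq_empty_iff_forall_notMem]
    intro P hP
    exact (mem_rem.1 (mem_on.1 hP).1).2 ((ev_iff_of_dvd ha hb.1 h P).2 (mem_on.1 hP).2)
  rw [hb.2] at this; omega

theorem P4 (hX : IsGC (n+1) X) {a b : Poly2} (ha : Mx (n+1) X a) (hb : Mx (n+1) X b) (hab : ¬ a ∣ b) :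
    ∃ P ∈ X, evalPt a P = 0 ∧ evalPt b P = 0 := by
  by_contra h
  push Not at h
  have h1 := (P6 hX ha hb hab).2
  have h2 : nodesOn (rem X a) b = nodesOn X b := by
    ext P; simp only [mem_on, mem_rem]
    constructor
    · tauto
    · rintro ⟨h3, h4⟩; exact ⟨⟨h3, fun h5 => h P h3 h5 h4⟩, h4⟩
  rw [h2, hb.2] at h1; omega

theorem mx_nonempty {a : Poly2} (ha : Mx n X a) : ∃ P ∈ X, evalPt a P = 0 := by
  obtain ⟨P, hP⟩ : (nodesOn X a).Nonempty := by
    rw [← Finset.card_pos, ha.2]; omega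
  exact ⟨P, (mem_on.1 hP).1, (mem_on.1 hP).2⟩

theorem card_zero (hX : IsGC 0 X) : ∃ P, X = {P} := by
  rw [← Finset.card_eq_one]; exact hX.1.1

/-- two distinct maximal lines of a remainder share a node or degree 0 -/
theorem P4' (hX : IsGC n X) {a b : Poly2} (ha : Mx n X a) (hb : Mx n X b) (hab : ¬ a ∣ b) :
    ∃ P ∈ X, evalPt a P = 0 ∧ evalPt b P = 0 := by
  cases n with
  | succ m => exact P4 hX ha hb hab
  | zero =>
    obtain ⟨P, rfl⟩ := card_zero hX
    obtain ⟨Q, hQ, h1⟩ := mx_nonempty ha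
    obtain ⟨R, hR, h2⟩ := mx_nonempty hb
    rw [Finset.mem_singleton] at hQ hR
    subst hQ; subst hR
    exact ⟨_, by simp, h1, h2⟩

theorem P5 (hX : IsGC (n+1) X) {a b c : Poly2} (ha : Mx (n+1) X a) (hb : Mx (n+1) X b)
    (hc : Mx (n+1) X c) (hab : ¬ a ∣ b) (hac : ¬ a ∣ c) (hbc : ¬ b ∣ c) {P : ℝ × ℝ}
    (h1 : evalPt a P = 0) (h2 : evalPt b P = 0) : evalPt c P ≠ 0 := by
  intro h3
  obtain ⟨Q, hQ, hQb, hQc⟩ := P4' (rem_GC hX ha) (P6 hX ha hb hab) (P6 hX ha hc hac) hbc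
  have := line_eq_pt hb.1 hc.1 hbc hQb h2 hQc h3
  rw [this] at hQ
  exact (mem_rem.1 hQ).2 h1

theorem uses_rem (hX : IsGC (n+1) X) {a ℓ : Poly2} (ha : Mx (n+1) X a) (hl : Ln ℓ) (hla : ¬ ℓ ∣ a) :
    usesSet n (rem X a) ℓ = rem (usesSet (n+1) X ℓ) a := by
  ext A
  rw [mem_uses (rem_GC hX ha), mem_rem (X := usesSet (n+1) X ℓ), mem_uses hX]
  constructor
  · rintro ⟨h1, h2⟩
    exact ⟨⟨rem_sub _ _ h1, (dvd_fd_rem hX ha h1 hl hla).2 h2⟩, (mem_rem.1 h1).2⟩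
  · rintro ⟨⟨h1, h2⟩, h3⟩
    exact ⟨mem_rem.2 ⟨h1, h3⟩, (dvd_fd_rem hX ha (mem_rem.2 ⟨h1, h3⟩) hl hla).1 h2⟩
end


/-! ### Number of maximal lines -/

section CG
variable {n : ℕ} {X : Finset (ℝ × ℝ)} {a v v' : Poly2} {P A A' : ℝ × ℝ}

theorem CG_key (hX : IsGC (n+2) X) (ha : Mx (n+2) X a) (hv : Mx (n+1) (rem X a) v)
    (hv' : Mx (n+1) (rem X a) v') (hvv : ¬ v ∣ v') (hd : Dj X a v) (hd' : Dj X a v')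
    (hP : P ∈ rem X a) (hPv : evalPt v P = 0) (hPv' : evalPt v' P = 0)
    (hA : A ∈ X) (hAa : evalPt a A = 0) (hA' : A' ∈ X) (hAa' : evalPt a A' = 0) (hne : A ≠ A')
    {L : Poly2} (hL : Ln L) (hLP : evalPt L P = 0) (hLA : L ∣ fd (n+2) X A) (hLA' : L ∣ fd (n+2) X A') :
    False := by
  classical
  obtain ⟨B, hB, hBa, hBA, hLB⟩ := M1x hX ha hA hAa hL hLA
  have hLA0 := fd_line_ne hX hA hLA
  have hLA0' := fd_line_ne hX hA' hLA'
  have haL : ¬ a ∣ L := fun h => hLA0 (ev_dvd h hAa)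
  have hvL : ¬ v ∣ L := fun h => LD hX ha hv hd hA hAa (h.trans hLA)
  have hvL' : ¬ v' ∣ L := fun h => LD hX ha hv' hd' hA hAa (h.trans hLA)
  obtain ⟨g, hg⟩ := hLA
  obtain ⟨g', hg'⟩ := hLA'
  have hgP := D2 hX ha hv hd hA hAa hL hg hP hPv hLP
  have hgP' := D2 hX ha hv hd hA' hAa' hL hg' hP hPv hLP
  have hgdeg : g.totalDegree ≤ n + 1 := deg_of_mul hL (hg ▸ fd_deg hX hA)
  have hgdeg' : g'.totalDegree ≤ n + 1 := deg_of_mul hL (hg' ▸ fd_deg hX hA')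
  set t := evalPt g P / evalPt g' P with ht
  set h := g - C t * g' with hh
  have hdeg : h.totalDegree ≤ n + 1 := by
    refine (totalDegree_sub _ _).trans (max_le hgdeg ?_)
    refine (totalDegree_mul _ _).trans ?_
    rw [totalDegree_C, zero_add]; exact hgdeg'
  have hP0 : evalPt h P = 0 := by
    rw [hh, ev_sub, ev_mul, ev_C, ht]; field_simp; ring
  -- vanishing where L is nonzero
  have hvan : ∀ Q ∈ X, Q ≠ A → Q ≠ A' → evalPt L Q ≠ 0 → evalPt h Q = 0 := by
    intro Q hQ h1 h2 h3
    have e1 := fd_other hX hA hQ h1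
    have e2 := fd_other hX hA' hQ h2
    rw [hg, ev_mul] at e1
    rw [hg', ev_mul] at e2
    rw [hh, ev_sub, ev_mul, (mul_eq_zero.1 e1).resolve_left h3, (mul_eq_zero.1 e2).resolve_left h3]
    ring
  have hline : ∀ w : Poly2, Mx (n+1) (rem X a) w → ¬ w ∣ L → evalPt w P = 0 → w ∣ h := by
    intro w hw hwL hwP
    apply F1 hw.1 hdeg (nodesOn (rem X a) w)
    · intro Q hQ; exact (mem_on.1 hQ).2
    · intro Q hQ
      by_cases hQP : Q = P
      · rw [hQP]; exact hP0
      have hQ1 := mem_on.1 hQ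
      have hQ2 := mem_rem.1 hQ1.1
      apply hvan Q hQ2.1
      · rintro rfl; exact hQ2.2 hAa
      · rintro rfl; exact hQ2.2 hAa'
      · intro h0; exact hQP (line_eq_pt hw.1 hL hwL hQ1.2 hwP h0 hLP)
    · rw [hw.2]; omega
  have h1 := hline v hv hvL hPv
  have h2 := hline v' hv' hvL' hPv'
  have hah : a ∣ h := by
    by_cases h0 : h = 0
    · rw [h0]; exact dvd_zero _
    obtain ⟨h', e1⟩ := h1
    rw [e1] at h2
    obtain ⟨r, e2⟩ : v' ∣ h' := (hv'.ln.prime.dvd_or_dvd h2).resolve_left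
      (fun h => hvv (dvd_symm_line hv'.1 hv.1 h))
    have hr : r ≠ 0 := by rintro rfl; apply h0; rw [e1, e2]; simp
    have d1 : h.totalDegree = h'.totalDegree + 1 := by
      rw [e1]; apply deg_mul_line hv.1; rw [e2]; exact mul_ne_zero hv'.ln.ne_zero hr
    have d2 : h'.totalDegree = r.totalDegree + 1 := by
      rw [e2]; exact deg_mul_line hv'.1 hr
    have : a ∣ r := by
      apply F1 ha.1 (d := n - 1) (by omega) ((((nodesOn X a).erase A).erase A').erase B)
      · intro Q hQ
        simp only [Finset.mem_erase, mem_on] at hQ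
        exact hQ.2.2.2.2
      · intro Q hQ
        simp only [Finset.mem_erase, mem_on] at hQ
        obtain ⟨q1, q2, q3, q4, q5⟩ := hQ
        have := hvan Q q4 q3 q2 (fun h0 => q1 (line_eq_pt ha.1 hL haL q5 hBa h0 hLB))
        rw [e1, e2, ev_mul, ev_mul] at this
        exact ((mul_eq_zero.1 this).resolve_left (hd Q q4 q5) |> mul_eq_zero.1).resolve_left (hd' Q q4 q5)
      · have c0 : (nodesOn X a).card = n + 3 := ha.2
        have := Finset.pred_card_le_card_erase (s := nodesOn X a) (a := A)
        have := Finset.pred_card_le_card_erase (s := (nodesOn X a).erase A) (a := A')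
        have := Finset.pred_card_le_card_erase (s := ((nodesOn X a).erase A).erase A') (a := B)
        omega
    rw [e1, e2]; exact (this.mul_left _).mul_left _
  have hfin := ev_dvd hah hAa
  have e1 := fd_self hX hA
  have e2 := fd_other hX hA' hA hne
  rw [hg, ev_mul] at e1
  rw [hg', ev_mul] at e2
  rw [hh, ev_sub, ev_mul, (mul_eq_zero.1 e2).resolve_left hLA0, mul_zero, sub_zero] at hfin
  rw [hfin] at e1; norm_num at e1

theorem CG (hX : IsGC (n+2) X) (ha : Mx (n+2) X a) (hv : Mx (n+1) (rem X a) v)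
    (hv' : Mx (n+1) (rem X a) v') {r : Poly2} (hr : Mx (n+1) (rem X a) r) (hvv : ¬ v ∣ v')
    (hvr : ¬ v ∣ r) (hvr' : ¬ v' ∣ r) (hd : Dj X a v) (hd' : Dj X a v') : False := by
  classical
  have hR := rem_GC hX ha
  obtain ⟨P, hP, hPv, hPv'⟩ := P4 hR hv hv' hvv
  have hrP := P5 hR hv hv' hr hvv hvr hvr' hPv hPv'
  have hPX := mem_rem.1 hP
  have hL : ∀ A ∈ nodesOn X a, ∃ L, Ln L ∧ L ∣ fd (n+2) X A ∧ evalPt L P = 0 := by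
    intro A hA
    have hA1 := mem_on.1 hA
    apply fd_line_through hX hA1.1
    apply fd_other hX hA1.1 hPX.1
    rintro rfl; exact hPX.2 hA1.2
  choose! L hLl hLd hLP using hL
  have hinj : ∀ A ∈ nodesOn X a, ∀ A' ∈ nodesOn X a, L A ∣ L A' → A = A' := by
    intro A hA A' hA' h
    by_contra hne
    have hA1 := mem_on.1 hA
    have hA2 := mem_on.1 hA'
    exact CG_key hX ha hv hv' hvv hd hd' hP hPv hPv' hA1.1 hA1.2 hA2.1 hA2.2 hne (hLl A hA) (hLP A hA)
      (hLd A hA) (h.trans (hLd A' hA'))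
  have hB : ∀ A ∈ nodesOn X a, ∃ B ∈ X, evalPt a B = 0 ∧ B ≠ A ∧ evalPt (L A) B = 0 := by
    intro A hA
    have hA1 := mem_on.1 hA
    exact M1x hX ha hA1.1 hA1.2 (hLl A hA) (hLd A hA)
  choose! B hBX hBa hBA hBL using hB
  by_cases hdr : Dj X a r
  · have hE : ∀ A ∈ nodesOn X a, ∃ E ∈ rem X a, evalPt r E = 0 ∧ evalPt (L A) E = 0 := by
      intro A hA
      have hA1 := mem_on.1 hA
      exact D1 hX ha hr hdr hA1.1 hA1.2 (hLl A hA) (hLd A hA)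
    choose! E hER hEr hEL using hE
    have hc : (nodesOn (rem X a) r).card < (nodesOn X a).card := by rw [ha.2, hr.2]; omega
    obtain ⟨A, hA, A', hA', hne, he⟩ := Finset.exists_ne_map_eq_of_card_lt_of_maps_to hc (f := E)
      (fun A hA => mem_on.2 ⟨hER A hA, hEr A hA⟩)
    apply hne
    apply hinj A hA A' hA'
    refine two_pts (hLl A hA) (hLl A' hA').le (P := P) (Q := E A) ?_ (hLP A hA) (hEL A hA) (hLP A' hA')
      (he ▸ hEL A' hA')
    intro h; rw [h] at hrP; exact hrP (hEr A hA)
  · unfold Dj at hdr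
    push Not at hdr
    obtain ⟨D, hD, hDa, hDr⟩ := hdr
    have hsurj := Finset.surjOn_of_injOn_of_card_le (s := nodesOn X a) (t := nodesOn X a) B
      (fun A hA => mem_on.2 ⟨hBX A hA, hBa A hA⟩) (by
        intro A hA A' hA' he
        apply hinj A hA A' hA'
        refine two_pts (hLl A hA) (hLl A' hA').le (P := P) (Q := B A) ?_ (hLP A hA) (hBL A hA) (hLP A' hA')
          (he ▸ hBL A' hA')
        intro h; exact hPX.2 (h ▸ hBa A hA)) le_rfl
    obtain ⟨A, hA, hAD⟩ := hsurj (mem_on.2 ⟨hD, hDa⟩ : D ∈ (nodesOn X a : Set (ℝ × ℝ)))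
    have hrX : Mx (n+2) X r := (P7 hX hr).resolve_right (fun h => h D hD hDa hDr)
    have har := not_dvd_rem ha.1 hr
    have hA1 := mem_on.1 hA
    have hAne : D ≠ A := hAD ▸ hBA A hA
    have hrA : evalPt r A ≠ 0 := fun h => hAne (line_eq_pt ha.1 hr.1 har hDa hA1.2 hDr h)
    obtain ⟨g, hg⟩ := mx_dvd_fd hX hrX hA1.1 hrA
    have hgD := M2x hX ha hA1.1 hA1.2 hr.1 hg hD hDa hDr
    have hLA := hLd A hA
    rw [hg] at hLA
    rcases (hLl A hA).prime.dvd_or_dvd hLA with h | h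
    · exact hrP (ev_dvd h (hLP A hA))
    · exact hgD (ev_dvd h (hAD ▸ hBL A hA))
end CG

abbrev GMU (N : ℕ) : Prop := ∀ m ≤ N, GM m

theorem three_max {N : ℕ} (hN : GMU N) : ∀ n, n + 1 ≤ N → ∀ X, IsGC (n+1) X → ∃ a b c, Mx (n+1) X a ∧
    Mx (n+1) X b ∧ Mx (n+1) X c ∧ ¬ a ∣ b ∧ ¬ a ∣ c ∧ ¬ b ∣ c := by
  classical
  intro n
  induction n with
  | zero =>
    intro _ X hX
    have hc : X.card = 3 := hX.1.1
    have hmax : ∀ P ∈ X, Mx 1 X (fd 1 X P) := by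
      intro P hP
      obtain ⟨f, hf, he⟩ := fd_prod hX hP
      have hl : Ln (fd 1 X P) := by rw [he]; simpa using hf 0
      refine ⟨hl, le_antisymm (line_bound hX hl) ?_⟩
      have : X.erase P ⊆ nodesOn X (fd 1 X P) := by
        intro Q hQ
        rw [Finset.mem_erase] at hQ
        exact mem_on.2 ⟨hQ.2, fd_other hX hP hQ.2 hQ.1⟩
      have := Finset.card_le_card this
      rw [Finset.card_erase_of_mem hP] at this
      omega
    have hnd : ∀ P ∈ X, ∀ Q ∈ X, P ≠ Q → ¬ fd 1 X P ∣ fd 1 X Q := by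
      intro P hP Q hQ hne h
      exact fd_line_ne hX hQ h (fd_other hX hP hQ hne.symm)
    obtain ⟨P, Q, R, h1, h2, h3, h4⟩ := Finset.card_eq_three.1 hc
    have hP : P ∈ X := by rw [h4]; simp
    have hQ : Q ∈ X := by rw [h4]; simp
    have hR : R ∈ X := by rw [h4]; simp
    exact ⟨_, _, _, hmax P hP, hmax Q hQ, hmax R hR, hnd P hP Q hQ h1, hnd P hP R hR h2, hnd Q hQ R hR h3⟩
  | succ n ih =>
    intro hn X hX
    obtain ⟨l, hl⟩ := hN (n+1+1) hn X hX
    obtain ⟨a, b, c, ha, hb, hc, hab, hac, hbc⟩ := ih (by omega) _ (rem_GC hX hl)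
    have na := not_dvd_rem hl.1 ha
    have nb := not_dvd_rem hl.1 hb
    have nc := not_dvd_rem hl.1 hc
    have hba : ¬ b ∣ a := fun h => hab (dvd_symm_line hb.1 ha.1 h)
    have hca : ¬ c ∣ a := fun h => hac (dvd_symm_line hc.1 ha.1 h)
    have hcb : ¬ c ∣ b := fun h => hbc (dvd_symm_line hc.1 hb.1 h)
    rcases P7 hX ha with h1 | h1 <;> rcases P7 hX hb with h2 | h2
    · exact ⟨l, a, b, hl, h1, h2, na, nb, hab⟩
    · rcases P7 hX hc with h3 | h3
      · exact ⟨l, a, c, hl, h1, h3, na, nc, hac⟩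
      · exact (CG hX hl hb hc ha hbc hba hca h2 h3).elim
    · rcases P7 hX hc with h3 | h3
      · exact ⟨l, b, c, hl, h2, h3, nb, nc, hbc⟩
      · exact (CG hX hl ha hc hb hac hab hcb h1 h3).elim
    · exact (CG hX hl ha hb hc hab hac hbc h1 h2).elim

structure Three (n : ℕ) (X : Finset (ℝ × ℝ)) (a b c : Poly2) : Prop where
  gc : IsGC n X
  ha : Mx n X a
  hb : Mx n X b
  hc : Mx n X c
  ab : ¬ a ∣ b
  ac : ¬ a ∣ c
  bc : ¬ b ∣ c
  all : ∀ d, Mx n X d → a ∣ d ∨ b ∣ d ∨ c ∣ d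

section
variable {n : ℕ} {X : Finset (ℝ × ℝ)} {a b c : Poly2}

theorem Three.rot (h : Three n X a b c) : Three n X b c a :=
  ⟨h.gc, h.hb, h.hc, h.ha, h.bc, fun h' => h.ab (dvd_symm_line h.hb.1 h.ha.1 h'),
    fun h' => h.ac (dvd_symm_line h.hc.1 h.ha.1 h'), fun d hd => by have := h.all d hd; tauto⟩

theorem Three.swap (h : Three n X a b c) : Three n X b a c :=
  ⟨h.gc, h.hb, h.ha, h.hc, fun h' => h.ab (dvd_symm_line h.hb.1 h.ha.1 h'), h.bc,
    h.ac, fun d hd => by have := h.all d hd; tauto⟩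

theorem Three.her {N : ℕ} (hN : GMU N) (hn : n + 2 ≤ N) (h : Three (n+2) X a b c) :
    ∃ d, Three (n+1) (rem X c) a b d ∧ Dj X c d := by
  have hR := rem_GC h.gc h.hc
  have ha := P6 h.gc h.hc h.ha (h.rot.bc)
  have hb := P6 h.gc h.hc h.hb (fun h' => h.bc (dvd_symm_line h.hc.1 h.hb.1 h'))
  obtain ⟨e1, e2, e3, m1, m2, m3, n12, n13, n23⟩ := three_max hN n (by omega) _ hR
  have hex : ∃ d, Mx (n+1) (rem X c) d ∧ ¬ a ∣ d ∧ ¬ b ∣ d := by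
    by_contra hcon
    push Not at hcon
    have tr : ∀ {x e f : Poly2}, Ln x → Ln e → x ∣ e → x ∣ f → e ∣ f :=
      fun hx he h1 h2 => (dvd_symm_line hx he h1).trans h2
    have k1 := hcon e1 m1
    have k2 := hcon e2 m2
    have k3 := hcon e3 m3
    by_cases q1 : a ∣ e1
    · by_cases q2 : a ∣ e2
      · exact n12 (tr ha.1 m1.1 q1 q2)
      · by_cases q3 : a ∣ e3
        · exact n13 (tr ha.1 m1.1 q1 q3)
        · exact n23 (tr hb.1 m2.1 (k2 q2) (k3 q3))
    · by_cases q2 : a ∣ e2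
      · by_cases q3 : a ∣ e3
        · exact n23 (tr ha.1 m2.1 q2 q3)
        · exact n13 (tr hb.1 m1.1 (k1 q1) (k3 q3))
      · exact n12 (tr hb.1 m1.1 (k1 q1) (k2 q2))
  obtain ⟨d, hd, had, hbd⟩ := hex
  have hnc := fun {e} (he : Mx (n+1) (rem X c) e) => not_dvd_rem h.hc.1 he
  have key : ∀ e, Mx (n+1) (rem X c) e → ¬ a ∣ e → ¬ b ∣ e → Dj X c e := by
    intro e he h1 h2
    refine (P7 h.gc he).resolve_left fun h3 => ?_
    rcases h.all e h3 with q | q | q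
    · exact h1 q
    · exact h2 q
    · exact hnc he q
  refine ⟨d, ⟨hR, ha, hb, hd, h.ab, had, hbd, ?_⟩, key d hd had hbd⟩
  intro e he
  by_contra hcon
  push Not at hcon
  exact CG h.gc h.hc hd he ha hcon.2.2 (fun h' => had (dvd_symm_line hd.1 ha.1 h'))
    (fun h' => hcon.1 (dvd_symm_line he.1 ha.1 h')) (key d hd had hbd) (key e he hcon.1 hcon.2.1)

theorem Three.repl {d : Poly2} (h : Three n X a b c) (hd : Ln d) (hcd : c ∣ d) : Three n X a b d :=
  ⟨h.gc, h.ha, h.hb, Mx_dvd h.hc hd hcd, h.ab,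
    fun h' => h.ac (h'.trans (dvd_symm_line h.hc.1 hd hcd)),
    fun h' => h.bc (h'.trans (dvd_symm_line h.hc.1 hd hcd)), fun e he => by
      rcases h.all e he with q | q | q
      · exact Or.inl q
      · exact Or.inr (Or.inl q)
      · exact Or.inr (Or.inr ((dvd_symm_line h.hc.1 hd hcd).trans q))⟩

theorem Three.swp {N : ℕ} (hN : GMU N) (hn : n + 3 ≤ N) {d f : Poly2} (_h : Three (n+3) X a b c)
    (hd : Three (n+2) (rem X c) a b d) (hcd : Dj X c d)
    (hf : Three (n+2) (rem X b) a c f) :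
    Three (n+1) (rem (rem X b) c) a f d := by
  obtain ⟨e, he, _⟩ := hd.swap.rot.her hN (by omega)
  rw [rem_comm] at he
  have hfm : Mx (n+1) (rem (rem X b) c) f := P6 hf.gc hf.hb hf.hc hf.bc
  have hdf : ¬ d ∣ f := by
    intro h'
    obtain ⟨P, hP, h1, h2⟩ := P4 hf.gc hf.hb hf.hc hf.bc
    exact hcd P (rem_sub _ _ hP) h1 (ev_dvd (dvd_symm_line hd.hc.1 hf.hc.1 h') h2)
  have hmem : e ∣ f := by
    rcases he.all f hfm with q | q | q
    · exact absurd q hf.ac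
    · exact absurd q hdf
    · exact q
  exact (he.repl hf.hc.1 hmem).swap.rot
end


/-! ### Sets with exactly three maximal lines -/

theorem nd_symm {a b : Poly2} (ha : Ln a) (hb : Ln b) (h : ¬ a ∣ b) : ¬ b ∣ a :=
  fun h' => h (dvd_symm_line hb ha h')

/-- In degree one the fundamental polynomial is a multiple of any line dividing it. -/
theorem fd_one {X : Finset (ℝ × ℝ)} (hX : IsGC 1 X) {A : ℝ × ℝ} (hA : A ∈ X) {b : Poly2} (hb : Ln b)
    (h : b ∣ fd 1 X A) : ∃ k : ℝ, k ≠ 0 ∧ fd 1 X A = C k * b := by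
  obtain ⟨f, hf, he⟩ := fd_prod hX hA
  have hl : Ln (fd 1 X A) := by rw [he]; simpa using hf 0
  exact dvd_line hb hl h

section
variable {N : ℕ} (hN : GMU N)
include hN

theorem VV : ∀ n, n + 2 ≤ N → ∀ (X : Finset (ℝ × ℝ)) (a b c d e : Poly2) (D P : ℝ × ℝ),
    Three (n+2) X a b c → Three (n+1) (rem X c) a b d → Dj X c d →
    Three (n+1) (rem X a) b c e → Dj X a e → D ∈ rem X c → evalPt a D = 0 → evalPt d D = 0 →
    P ∈ rem X a → evalPt e P = 0 → evalPt c P = 0 →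
    (∃ k : ℝ, k ≠ 0 ∧ fd (n+1) (rem X c) D = C k * fd (n+1) (rem X a) P) ∧
    ∀ V ∈ X, evalPt a V = 0 → evalPt c V = 0 → evalPt (fd (n+1) (rem X c) D) V ≠ 0 := by
  intro n
  induction n with
  | zero =>
    intro _ X a b c d e D P h hd hcd he hae hD hDa hDd hP hPe hPc
    have hbD : evalPt b D ≠ 0 := P5 hd.gc hd.ha hd.hc hd.hb hd.ac hd.ab
      (nd_symm hd.hb.1 hd.hc.1 hd.bc) hDa hDd
    have hbP : evalPt b P ≠ 0 := P5 he.gc he.hc he.hb he.ha (nd_symm he.hb.1 he.hc.1 he.bc)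
      (nd_symm he.ha.1 he.hc.1 he.ac) (nd_symm he.ha.1 he.hb.1 he.ab) hPe hPc
    obtain ⟨k, hk, h1⟩ := fd_one hd.gc hD hd.hb.1 (mx_dvd_fd hd.gc hd.hb hD hbD)
    obtain ⟨k', hk', h2⟩ := fd_one he.gc hP he.ha.1 (mx_dvd_fd he.gc he.ha hP hbP)
    refine ⟨⟨k * k'⁻¹, mul_ne_zero hk (inv_ne_zero hk'), ?_⟩, ?_⟩
    · rw [h1, h2, ← mul_assoc, ← C_mul, mul_assoc, inv_mul_cancel₀ hk', mul_one]
    · intro V hV hVa hVc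
      rw [h1, ev_mul, ev_C]
      exact mul_ne_zero hk (P5 h.gc h.ha h.hc h.hb h.ac h.ab (nd_symm h.hb.1 h.hc.1 h.bc) hVa hVc)
  | succ n ih =>
    intro hn X a b c d e D P h hd hcd he hae hD hDa hDd hP hPe hPc
    have hbD : evalPt b D ≠ 0 := P5 hd.gc hd.ha hd.hc hd.hb hd.ac hd.ab
      (nd_symm hd.hb.1 hd.hc.1 hd.bc) hDa hDd
    have hbP : evalPt b P ≠ 0 := P5 he.gc he.hc he.hb he.ha (nd_symm he.hb.1 he.hc.1 he.bc)
      (nd_symm he.ha.1 he.hc.1 he.ac) (nd_symm he.ha.1 he.hb.1 he.ab) hPe hPc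
    obtain ⟨f, hf, hbf⟩ := h.swap.rot.her hN (by omega)
    have s1 := h.swp hN (by omega) hd hcd hf
    have s2 := h.rot.swap.swp hN (by omega) he.swap hae hf.swap
    have hD' : D ∈ rem (rem X b) c := by
      rw [rem_comm]; exact mem_rem.2 ⟨hD, hbD⟩
    have hP' : P ∈ rem (rem X b) a := by
      rw [rem_comm]; exact mem_rem.2 ⟨hP, hbP⟩
    obtain ⟨⟨k, hk, e1⟩, e2⟩ := ih (by omega) (rem X b) a f c d e D P hf.swap.rot s1
      (hcd.sub (rem_sub _ _)) s2.swap (hae.sub (rem_sub _ _)) hD' hDa hDd hP' hPe hPc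
    have r1 := fd_rem hd.gc hd.hb (mem_rem.2 ⟨hD, hbD⟩)
    have r2 := fd_rem he.gc he.ha (mem_rem.2 ⟨hP, hbP⟩)
    rw [rem_comm X c b] at r1
    rw [rem_comm X a b] at r2
    refine ⟨⟨k * ((evalPt b D)⁻¹ * (evalPt b P)), mul_ne_zero hk (mul_ne_zero (inv_ne_zero hbD) hbP), ?_⟩, ?_⟩
    · rw [r1, r2, e1]
      have : (C (evalPt b P) : Poly2) * C (evalPt b P)⁻¹ = 1 := by
        rw [← C_mul, mul_inv_cancel₀ hbP, C_1]
      rw [C_mul, C_mul]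
      linear_combination (-(C k * C (evalPt b D)⁻¹ * b * fd (n+1) (rem (rem X b) a) P)) * this
    · intro V hV hVa hVc
      have hbV : evalPt b V ≠ 0 := P5 h.gc h.ha h.hc h.hb h.ac h.ab (nd_symm h.hb.1 h.hc.1 h.bc) hVa hVc
      rw [r1, ev_mul, ev_mul, ev_C]
      exact mul_ne_zero (inv_ne_zero hbD) (mul_ne_zero hbV (e2 V (mem_rem.2 ⟨hV, hbV⟩) hVa hVc))

theorem WW : ∀ n, n + 2 ≤ N → ∀ (X : Finset (ℝ × ℝ)) (a b c d : Poly2) (B : ℝ × ℝ),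
    Three (n+2) X a b c → Three (n+1) (rem X c) a b d → Dj X c d → B ∈ X → evalPt c B = 0 →
    ∃ D D', D ∈ rem X c ∧ evalPt d D = 0 ∧ evalPt (fd (n+1) (rem X c) D) B ≠ 0 ∧
      (∀ E ∈ rem X c, evalPt d E = 0 → E ≠ D → E ≠ D' → evalPt (fd (n+1) (rem X c) E) B = 0) ∧
      (evalPt a B = 0 → D' = D) := by
  intro n
  induction n with
  | zero =>
    intro hn X a b c d B h hd hcd hB hBc
    by_cases hBa : evalPt a B = 0
    · obtain ⟨D, hD, hDa, hDd⟩ := P4 hd.gc hd.ha hd.hc hd.ac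
      obtain ⟨e, he, hae⟩ := h.rot.her hN (by omega)
      obtain ⟨P, hP, hPe, hPc⟩ := P4 he.gc he.hc he.hb (nd_symm he.hb.1 he.hc.1 he.bc)
      refine ⟨D, D, hD, hDd, (VV hN 0 hn X a b c d e D P h hd hcd he hae hD hDa hDd hP hPe hPc).2 B hB hBa hBc,
        ?_, fun _ => rfl⟩
      intro E hE hEd hne _
      exact ev_dvd (mx_dvd_fd hd.gc hd.ha hE
        (fun h0 => hne (line_eq_pt hd.ha.1 hd.hc.1 hd.ac h0 hDa hEd hDd))) hBa
    · obtain ⟨D', hD', hDa', hDd'⟩ := P4 hd.gc hd.ha hd.hc hd.ac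
      obtain ⟨D, hD, hDb, hDd⟩ := P4 hd.gc hd.hb hd.hc hd.bc
      have haD : evalPt a D ≠ 0 := P5 hd.gc hd.hb hd.hc hd.ha hd.bc (nd_symm hd.ha.1 hd.hb.1 hd.ab)
        (nd_symm hd.ha.1 hd.hc.1 hd.ac) hDb hDd
      refine ⟨D, D', hD, hDd, ?_, ?_, fun h => absurd h hBa⟩
      · obtain ⟨k, hk, e⟩ := fd_one hd.gc hD hd.ha.1 (mx_dvd_fd hd.gc hd.ha hD haD)
        rw [e, ev_mul, ev_C]; exact mul_ne_zero hk hBa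
      · intro E hE hEd h1 h2
        exfalso
        have q1 : evalPt a E ≠ 0 := fun h0 => h2 (line_eq_pt hd.ha.1 hd.hc.1 hd.ac h0 hDa' hEd hDd')
        have q2 : evalPt b E ≠ 0 := fun h0 => h1 (line_eq_pt hd.hb.1 hd.hc.1 hd.bc h0 hDb hEd hDd)
        obtain ⟨k, hk, e⟩ := fd_one hd.gc hE hd.ha.1 (mx_dvd_fd hd.gc hd.ha hE q1)
        have := mx_dvd_fd hd.gc hd.hb hE q2
        rw [e, C_dvd hk] at this
        exact hd.ab (dvd_symm_line hd.hb.1 hd.ha.1 this)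
  | succ n ih =>
    intro hn X a b c d B h hd hcd hB hBc
    obtain ⟨e, he, hae⟩ := h.rot.her hN (by omega)
    obtain ⟨P, hP, hPe, hPc⟩ := P4 he.gc he.hc he.hb (nd_symm he.hb.1 he.hc.1 he.bc)
    obtain ⟨D₀, hD₀, hDa, hDd⟩ := P4 hd.gc hd.ha hd.hc hd.ac
    have hV := VV hN (n+1) hn X a b c d e D₀ P h hd hcd he hae hD₀ hDa hDd hP hPe hPc
    by_cases hBa : evalPt a B = 0
    · refine ⟨D₀, D₀, hD₀, hDd, hV.2 B hB hBa hBc, ?_, fun _ => rfl⟩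
      intro E hE hEd hne _
      exact ev_dvd (mx_dvd_fd hd.gc hd.ha hE
        (fun h0 => hne (line_eq_pt hd.ha.1 hd.hc.1 hd.ac h0 hDa hEd hDd))) hBa
    have hBY : B ∈ rem X a := mem_rem.2 ⟨hB, hBa⟩
    have s1 := h.swap.swp hN (by omega) hd.swap hcd he
    obtain ⟨D, D', i1, i2, i3, i4, i5⟩ := ih (by omega) (rem X a) e b c d B he.rot.rot s1.swap
      (hcd.sub (rem_sub _ _)) hBY hBc
    have tr : ∀ E, E ∈ rem (rem X a) c → fd (n+2) (rem X c) E =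
        C (evalPt a E)⁻¹ * (a * fd (n+1) (rem (rem X a) c) E) := by
      intro E hE
      rw [rem_comm] at hE ⊢
      exact fd_rem hd.gc hd.ha hE
    have hD : D ∈ rem X c ∧ evalPt a D ≠ 0 := by rw [rem_comm] at i1; exact mem_rem.1 i1
    have key : ∀ E ∈ rem X c, evalPt d E = 0 → E ≠ D → E ≠ D' → E ≠ D₀ →
        evalPt (fd (n+2) (rem X c) E) B = 0 := by
      intro E hE hEd h1 h2 h3
      have haE : evalPt a E ≠ 0 := fun h0 => h3 (line_eq_pt hd.ha.1 hd.hc.1 hd.ac h0 hDa hEd hDd)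
      have hE' : E ∈ rem (rem X a) c := by rw [rem_comm]; exact mem_rem.2 ⟨hE, haE⟩
      rw [tr E hE', ev_mul, ev_mul, i4 E hE' hEd h1 h2]; ring
    have hDB : evalPt (fd (n+2) (rem X c) D) B ≠ 0 := by
      rw [tr D i1, ev_mul, ev_mul, ev_C]
      exact mul_ne_zero (inv_ne_zero hD.2) (mul_ne_zero hBa i3)
    by_cases hBe : evalPt e B = 0
    · refine ⟨D, D₀, hD.1, i2, hDB, ?_, fun h0 => absurd h0 hBa⟩
      intro E hE hEd h1 h2
      exact key E hE hEd h1 (by rw [i5 hBe]; exact h1) h2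
    · refine ⟨D, D', hD.1, i2, hDB, ?_, fun h0 => absurd h0 hBa⟩
      intro E hE hEd h1 h2
      by_cases h3 : E = D₀
      · obtain ⟨k, hk, ek⟩ := hV.1
        have : evalPt (fd (n+2) (rem X a) P) B = 0 := fd_other he.gc hP hBY
          (by rintro rfl; exact hBe hPe)
        show evalPt (fd (n+1+1) (rem X c) E) B = 0
        rw [h3, ek, ev_mul, this, mul_zero]
      · exact key E hE hEd h1 h2 h3

theorem QQ : ∀ n, n + 1 ≤ N → ∀ (X : Finset (ℝ × ℝ)) (a b c ℓ : Poly2) (A : ℝ × ℝ),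
    Three (n+1) X a b c → A ∈ X → evalPt a A = 0 → evalPt b A = 0 → Ln ℓ → ℓ ∣ fd (n+1) X A →
    ¬ c ∣ ℓ → Dj X c ℓ := by
  classical
  intro n
  induction n with
  | zero =>
    intro _ X a b c ℓ A h hA hAa hAb hl hlA hcl
    exfalso
    have hc : evalPt c A ≠ 0 := P5 h.gc h.ha h.hb h.hc h.ab h.ac h.bc hAa hAb
    obtain ⟨k, hk, e⟩ := fd_one h.gc hA h.hc.1 (mx_dvd_fd h.gc h.hc hA hc)
    rw [e, C_dvd hk] at hlA
    exact hcl (dvd_symm_line hl h.hc.1 hlA)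
  | succ n ih =>
    intro hn X a b c ℓ A h hA hAa hAb hl hlA hcl B hB hBc hBl
    have hc : evalPt c A ≠ 0 := P5 h.gc h.ha h.hb h.hc h.ab h.ac h.bc hAa hAb
    obtain ⟨d, hd, hcd⟩ := h.her hN (by omega)
    have hAY : A ∈ rem X c := mem_rem.2 ⟨hA, hc⟩
    have hlA' := (dvd_fd_rem h.gc h.hc hAY hl (fun h' => hcl (dvd_symm_line hl h.hc.1 h'))).1 hlA
    have hdA : evalPt d A ≠ 0 := P5 hd.gc hd.ha hd.hb hd.hc hd.ab hd.ac hd.bc hAa hAb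
    have hAZ : A ∈ rem (rem X c) d := mem_rem.2 ⟨hAY, hdA⟩
    have hdl : ¬ ℓ ∣ d := fun h' => hcd B hB hBc (ev_dvd h' hBl)
    have hlR := (dvd_fd_rem hd.gc hd.hc hAZ hl hdl).1 hlA'
    have hfR := fd_rem hd.gc hd.hc hAZ
    have hZ := rem_GC hd.gc hd.hc
    set R := fd n (rem (rem X c) d) A with hR
    obtain ⟨D, D', w1, w2, w3, w4, -⟩ := WW hN n (by omega) X a b c d B h hd hcd hB hBc
    obtain ⟨L, hL1, hL2, hL3⟩ : ∃ L : Poly2, L.totalDegree ≤ 1 ∧ evalPt L D ≠ 0 ∧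
        (D' ≠ D → evalPt L D' = 0) := by
      by_cases hDD : D' = D
      · exact ⟨1, by simp, by rw [ev_one]; norm_num, fun h => absurd hDD h⟩
      · obtain ⟨L, h1, h2, h3⟩ := exists_line_sep hDD
        exact ⟨L, h1, h3, fun _ => h2⟩
    have hRD : evalPt R D ≠ 0 := by
      intro h0
      obtain ⟨ℓ', l1, l2, l3⟩ := fd_line_through hZ hAZ h0
      have l4 : ℓ' ∣ fd (n+1) (rem X c) A := by
        rw [hfR]; exact (l2.mul_left d).mul_left _
      by_cases hdl' : d ∣ ℓ'
      · obtain ⟨P, hP, hPa, hPd⟩ := P4 hd.gc hd.ha hd.hc hd.ac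
        refine M2x hd.gc hd.ha hAY hAa hd.hc.1 (g := C (evalPt d A)⁻¹ * R) (by rw [hfR]; ring) hP hPa hPd ?_
        rw [ev_mul, ev_dvd (hdl'.trans l2) hPd, mul_zero]
      · exact ih (by omega) (rem X c) a b d ℓ' A hd hAY hAa hAb l1 l4 hdl' D w1 w2 l3
    have hq : (L * R).totalDegree ≤ n + 1 := by
      refine (totalDegree_mul _ _).trans ?_
      have : R.totalDegree ≤ n := fd_deg hZ hAZ
      omega
    have hlag := congrArg (fun p => evalPt p B) (lagrange hd.gc hq)
    simp only [ev_sum, ev_mul, ev_C] at hlag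
    rw [ev_dvd hlR hBl, mul_zero, Finset.sum_eq_single D] at hlag
    · exact mul_ne_zero (mul_ne_zero hL2 hRD) w3 hlag.symm
    · intro E hE hED
      by_cases hEA : E = A
      · rw [hEA, ev_dvd hlA' hBl, mul_zero]
      by_cases hdE : evalPt d E = 0
      · by_cases hED' : E = D'
        · rw [hED', hL3 (by rw [← hED']; exact hED)]; ring
        · rw [w4 E hE hdE hED hED', mul_zero]
      · rw [fd_other hZ hAZ (mem_rem.2 ⟨hE, hdE⟩) hEA]; ring
    · intro h; exact absurd w1 h
end


theorem deg_zero_line {X : Finset (ℝ × ℝ)} (hX : IsGC 0 X) {A : ℝ × ℝ} (hA : A ∈ X) {b : Poly2} (hb : Ln b)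
    (h : b ∣ fd 0 X A) : False := by
  obtain ⟨g, hg⟩ := h
  have h1 := fd_deg hX hA
  have h2 := fd_ne hX hA
  have hg0 : g ≠ 0 := by rintro rfl; apply h2; rw [hg, mul_zero]
  rw [hg, deg_mul_line hb hg0] at h1
  omega

/-- sum of the fundamental polynomials -/
theorem sum_fd {n : ℕ} {X : Finset (ℝ × ℝ)} (hX : IsGC n X) : (1 : Poly2) = ∑ D ∈ X, fd n X D := by
  have := lagrange hX (q := 1) (by simp)
  simpa [ev_one] using this

def Null (n : ℕ) (X : Finset (ℝ × ℝ)) (ℓ : Poly2) (F : ℝ × ℝ) : Prop :=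
  ∀ A ∈ X, ∀ g, fd n X A = ℓ * g → evalPt g F = 0

section
variable {N : ℕ} (hN : GMU N)
include hN

theorem T4 : ∀ n, n ≤ N → ∀ (X : Finset (ℝ × ℝ)) (ℓ : Poly2) (F : ℝ × ℝ), IsGC n X → Ln ℓ → F ∈ X →
    evalPt ℓ F = 0 → Null n X ℓ F → ∀ A ∈ X, ℓ ∣ fd n X A →
    ∃ u v, Ln u ∧ Ln v ∧ evalPt u F = 0 ∧ evalPt v F = 0 ∧ ℓ * (u * v) ∣ fd n X A := by
  intro n
  induction n with
  | zero =>
    intro _ X ℓ F hX hl hF hlF hnull A hA hd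
    exact (deg_zero_line hX hA hl hd).elim
  | succ n ih =>
    intro hn X ℓ F hX hl hF hlF hnull A hA hd
    by_cases hmax : Mx (n+1) X ℓ
    · exfalso
      have hR := rem_GC hX hmax
      have h1 := congrArg (fun p => evalPt p F) (sum_fd hR)
      simp only [ev_one, ev_sum] at h1
      rw [Finset.sum_eq_zero] at h1
      · norm_num at h1
      · intro D hD
        have h2 := hnull D (rem_sub _ _ hD) (C (evalPt ℓ D)⁻¹ * fd n (rem X ℓ) D)
          (by rw [fd_rem hX hmax hD]; ring)
        rw [ev_mul, ev_C] at h2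
        exact (mul_eq_zero.1 h2).resolve_left (inv_ne_zero (mem_rem.1 hD).2)
    have hnl : ∀ m, Mx (n+1) X m → ¬ m ∣ ℓ := fun m hm h => hmax (Mx_dvd hm hl h)
    by_cases hex : ∃ m, Mx (n+1) X m ∧ evalPt m F ≠ 0 ∧ evalPt m A ≠ 0
    · obtain ⟨m, hm, hmF, hmA⟩ := hex
      have hAm := mem_rem.2 ⟨hA, hmA⟩
      have hlm := nd_symm hm.1 hl (hnl m hm)
      obtain ⟨u, v, h1, h2, h3, h4, h5⟩ := ih (by omega) (rem X m) ℓ F (rem_GC hX hm) hl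
        (mem_rem.2 ⟨hF, hmF⟩) hlF (by
          intro D hD g hg
          have := hnull D (rem_sub _ _ hD) (C (evalPt m D)⁻¹ * (m * g)) (by
            rw [fd_rem hX hm hD, hg]; ring)
          rw [ev_mul, ev_mul, ev_C] at this
          exact ((mul_eq_zero.1 this).resolve_left (inv_ne_zero (mem_rem.1 hD).2) |>
            mul_eq_zero.1).resolve_left hmF) A hAm ((dvd_fd_rem hX hm hAm hl hlm).1 hd)
      exact ⟨u, v, h1, h2, h3, h4, h5.trans ((Dvd.intro_left _ rfl).trans (fd_rem_dvd hX hm hAm))⟩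
    push Not at hex
    have hF0 : ∀ m, Mx (n+1) X m → evalPt m F = 0 → evalPt m A ≠ 0 := by
      intro m hm hmF hmA
      obtain ⟨g, hg⟩ := hd
      exact M2x hX hm hA hmA hl hg hF hmF hlF (hnull A hA g hg)
    have two : ∀ a b, Mx (n+1) X a → Mx (n+1) X b → ¬ a ∣ b → evalPt a F = 0 → evalPt b F = 0 →
        ∃ u v, Ln u ∧ Ln v ∧ evalPt u F = 0 ∧ evalPt v F = 0 ∧ ℓ * (u * v) ∣ fd (n+1) X A := by
      intro a b ha hb hab haF hbF
      refine ⟨a, b, ha.1, hb.1, haF, hbF, ?_⟩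
      have h1 := mx_dvd_fd hX ha hA (hF0 a ha haF)
      have h2 := mx_dvd_fd hX hb hA (hF0 b hb hbF)
      obtain ⟨g, hg⟩ := hd
      rw [hg] at h1 h2 ⊢
      obtain ⟨g1, rfl⟩ := (ha.ln.prime.dvd_or_dvd h1).resolve_left (hnl a ha)
      have h3 := (hb.ln.prime.dvd_or_dvd h2).resolve_left (hnl b hb)
      have h4 := (hb.ln.prime.dvd_or_dvd h3).resolve_left (nd_symm ha.1 hb.1 hab)
      exact mul_dvd_mul_left _ (mul_dvd_mul_left _ h4)
    by_cases h2 : ∃ a b, Mx (n+1) X a ∧ Mx (n+1) X b ∧ ¬ a ∣ b ∧ evalPt a F = 0 ∧ evalPt b F = 0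
    · obtain ⟨a, b, h⟩ := h2
      exact two a b h.1 h.2.1 h.2.2.1 h.2.2.2.1 h.2.2.2.2
    exfalso
    push Not at h2
    have main : ∀ a b c, Mx (n+1) X a → Mx (n+1) X b → Mx (n+1) X c → ¬ a ∣ b → ¬ a ∣ c → ¬ b ∣ c →
        evalPt c F = 0 → False := by
      intro a b c ha hb hc hab hac hbc hcF
      have haF : evalPt a F ≠ 0 := fun h => h2 a c ha hc hac h hcF
      have hbF : evalPt b F ≠ 0 := fun h => h2 b c hb hc hbc h hcF
      have haA := hex a ha haF
      have hbA := hex b hb hbF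
      have hT : Three (n+1) X a b c := by
        refine ⟨hX, ha, hb, hc, hab, hac, hbc, ?_⟩
        intro d hd'
        by_contra hcon
        push Not at hcon
        by_cases hdF : evalPt d F = 0
        · exact h2 c d hc hd' hcon.2.2 hcF hdF
        · exact P5 hX ha hb hd' hab hcon.1 hcon.2.1 haA hbA (hex d hd' hdF)
      exact QQ hN n hn X a b c ℓ A hT hA haA hbA hl hd (hnl c hc) F hF hcF hlF
    obtain ⟨a, b, c, ha, hb, hc, hab, hac, hbc⟩ := three_max hN n hn X hX
    by_cases q1 : evalPt c F = 0
    · exact main a b c ha hb hc hab hac hbc q1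
    by_cases q2 : evalPt b F = 0
    · exact main a c b ha hc hb hac hab (nd_symm hb.1 hc.1 hbc) q2
    by_cases q3 : evalPt a F = 0
    · exact main b c a hb hc ha hbc (nd_symm ha.1 hb.1 hab) (nd_symm ha.1 hc.1 hac) q3
    exact P5 hX ha hb hc hab hac hbc (hex a ha q3) (hex b hb q2) (hex c hc q1)
end


/-! ### Four maximal lines -/

structure Quad (D : ℕ) (X : Finset (ℝ × ℝ)) (l v : Fin 4 → Poly2) : Prop where
  gc : IsGC (D+1) X
  hl : ∀ i, Mx (D+1) X (l i)
  ll : ∀ i j, i ≠ j → ¬ l i ∣ l j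
  all : ∀ d, Mx (D+1) X d → ∃ i, l i ∣ d
  hv : ∀ i, Mx D (rem X (l i)) (v i)
  dj : ∀ i, Dj X (l i) (v i)

/-- bookkeeping when removing pairs of lines -/
structure Cfg (d : ℕ) (Y : Finset (ℝ × ℝ)) (l v : Fin 4 → Poly2) (s : Finset (Fin 4)) : Prop where
  gc : IsGC d Y
  hl : ∀ i ∈ s, Mx d Y (l i)
  hv : ∀ i ∈ s, ∀ e, d = e + 1 → Mx e (rem Y (l i)) (v i)

structure Lns (l v : Fin 4 → Poly2) : Prop where
  l1 : ∀ i, Ln (l i)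
  v1 : ∀ i, Ln (v i)
  ll : ∀ i j, i ≠ j → ¬ l i ∣ l j
  lv : ∀ i j, ¬ l i ∣ v j
  vv : ∀ i j, i ≠ j → ¬ v i ∣ v j

theorem Lns.vl {l v : Fin 4 → Poly2} (h : Lns l v) (i j : Fin 4) : ¬ v i ∣ l j :=
  nd_symm (h.l1 j) (h.v1 i) (h.lv j i)

theorem Cfg.step {d : ℕ} {Y : Finset (ℝ × ℝ)} {l v : Fin 4 → Poly2} {s : Finset (Fin 4)}
    (h : Cfg (d+2) Y l v s) (hL : Lns l v) {i : Fin 4} (hi : i ∈ s) :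
    Cfg d (rem (rem Y (l i)) (v i)) l v (s.erase i) := by
  have g1 := rem_GC h.gc (h.hl i hi)
  have mv := h.hv i hi (d+1) rfl
  refine ⟨rem_GC g1 mv, ?_, ?_⟩
  · intro j hj
    rw [Finset.mem_erase] at hj
    exact P6 g1 mv (P6 h.gc (h.hl i hi) (h.hl j hj.2) (hL.ll i j hj.1.symm)) (hL.vl i j)
  · intro j hj e he
    subst he
    rw [Finset.mem_erase] at hj
    have m1 := P6 h.gc (h.hl i hi) (h.hl j hj.2) (hL.ll i j hj.1.symm)
    have m2 := P6 h.gc (h.hl j hj.2) (h.hl i hi) (hL.ll j i hj.1)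
    have g2 := rem_GC h.gc (h.hl j hj.2)
    have w1 := P6 g2 m2 (h.hv j hj.2 (e+1+1) rfl) (hL.lv i j)
    have w2 := P6 g1 m1 mv (hL.lv j i)
    have g3 := rem_GC g1 m1
    rw [rem_comm] at w1
    have := P6 g3 w2 w1 (hL.vv i j hj.1.symm)
    rwa [rem_comm] at this

theorem Quad.lns {D : ℕ} {X : Finset (ℝ × ℝ)} {l v : Fin 4 → Poly2} (h : Quad D X l v) : Lns l v := by
  have lv : ∀ i j, ¬ l i ∣ v j := by
    intro i j hd
    by_cases hij : i = j
    · subst hij; exact not_dvd_rem (h.hl i).1 (h.hv i) hd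
    · obtain ⟨P, hP, h1, h2⟩ := P4 h.gc (h.hl i) (h.hl j) (h.ll i j hij)
      exact h.dj j P hP h2 (ev_dvd hd h1)
  refine ⟨fun i => (h.hl i).1, fun i => (h.hv i).1, h.ll, lv, ?_⟩
  intro i j hij hd
  have m1 := P6 h.gc (h.hl i) (h.hl j) (h.ll i j hij)
  obtain ⟨P, hP, h1, h2⟩ := P4' (rem_GC h.gc (h.hl i)) (h.hv i) m1
    (nd_symm (h.hl j).1 (h.hv i).1 (lv j i))
  exact h.dj j P (rem_sub _ _ hP) h2 (ev_dvd hd h1)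

theorem Quad.cfg {D : ℕ} {X : Finset (ℝ × ℝ)} {l v : Fin 4 → Poly2} (h : Quad D X l v) :
    Cfg (D+1) X l v Finset.univ :=
  ⟨h.gc, fun i _ => h.hl i, fun i _ e he => by obtain rfl : D = e := by omega
                                               exact h.hv i⟩

section
variable {N : ℕ} (hN : GMU N)

/-- degree 5 -/
theorem Quad.five {X : Finset (ℝ × ℝ)} {l v : Fin 4 → Poly2} (h : Quad 4 X l v) : False := by
  have hL := h.lns
  -- remove all four lines
  have key : ∀ i j k m : Fin 4, i ≠ j → i ≠ k → i ≠ m → j ≠ k → j ≠ m → k ≠ m →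
      IsGC 1 (rem (rem (rem (rem X (l i)) (l j)) (l k)) (l m)) ∧
      Mx 1 (rem (rem (rem (rem X (l i)) (l j)) (l k)) (l m)) (v i) := by
    intro i j k m ij ik im jk jm km
    have g1 := rem_GC h.gc (h.hl i)
    have a1 := fun x (hx : i ≠ x) => P6 h.gc (h.hl i) (h.hl x) (h.ll i x hx)
    have g2 := rem_GC g1 (a1 j ij)
    have a2 := fun x (hx : i ≠ x) (hx2 : j ≠ x) => P6 g1 (a1 j ij) (a1 x hx) (h.ll j x hx2)
    have g3 := rem_GC g2 (a2 k ik jk)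
    have a3 := P6 g2 (a2 k ik jk) (a2 m im jm) (h.ll k m km)
    have v1 := h.hv i
    have v2 := P6 g1 (a1 j ij) v1 (hL.lv j i)
    have v3 := P6 g2 (a2 k ik jk) v2 (hL.lv k i)
    exact ⟨rem_GC g3 a3, P6 g3 a3 v3 (hL.lv m i)⟩
  have e : ∀ i j k m : Fin 4, (rem (rem (rem (rem X (l i)) (l j)) (l k)) (l m)) =
      rem X (l i * l j * l k * l m) := by intros; simp only [rem_rem]
  have k0 := key 0 1 2 3 (by decide) (by decide) (by decide) (by decide) (by decide) (by decide)
  have k1 := key 1 0 2 3 (by decide) (by decide) (by decide) (by decide) (by decide) (by decide)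
  have k2 := key 2 0 1 3 (by decide) (by decide) (by decide) (by decide) (by decide) (by decide)
  have k3 := key 3 0 1 2 (by decide) (by decide) (by decide) (by decide) (by decide) (by decide)
  rw [e] at k0 k1 k2 k3
  rw [show l 1 * l 0 * l 2 * l 3 = l 0 * l 1 * l 2 * l 3 by ring] at k1
  rw [show l 2 * l 0 * l 1 * l 3 = l 0 * l 1 * l 2 * l 3 by ring] at k2
  rw [show l 3 * l 0 * l 1 * l 2 = l 0 * l 1 * l 2 * l 3 by ring] at k3
  have n1 := P6 k0.1 k0.2 k1.2 (hL.vv 0 1 (by decide))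
  have n2 := P6 k0.1 k0.2 k2.2 (hL.vv 0 2 (by decide))
  have n3 := P6 k0.1 k0.2 k3.2 (hL.vv 0 3 (by decide))
  obtain ⟨P, hP⟩ := card_zero (rem_GC k0.1 k0.2)
  have on : ∀ x, Mx 0 (rem (rem X (l 0 * l 1 * l 2 * l 3)) (v 0)) x → evalPt x P = 0 := by
    intro x hx
    obtain ⟨Q, hQ, h1⟩ := mx_nonempty hx
    rw [hP, Finset.mem_singleton] at hQ
    rw [← hQ]; exact h1
  exact P5 k1.1 k1.2 k2.2 k3.2 (hL.vv 1 2 (by decide)) (hL.vv 1 3 (by decide)) (hL.vv 2 3 (by decide))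
    (on _ n1) (on _ n2) (on _ n3)

theorem fin4_cases (i j k m : Fin 4) (ij : i ≠ j) (ik : i ≠ k) (im : i ≠ m) (jk : j ≠ k) (jm : j ≠ m)
    (km : k ≠ m) (x : Fin 4) : x = i ∨ x = j ∨ x = k ∨ x = m := by
  omega

theorem fin4_others (i j : Fin 4) (ij : i ≠ j) : ∃ k m : Fin 4, i ≠ k ∧ i ≠ m ∧ j ≠ k ∧ j ≠ m ∧ k ≠ m := by
  decide +revert

/-- `X_i` -/
noncomputable def Xi (X : Finset (ℝ × ℝ)) (l v : Fin 4 → Poly2) (i : Fin 4) : Finset (ℝ × ℝ) :=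
  rem (rem X (l i)) (v i)

theorem Xi_comm (X : Finset (ℝ × ℝ)) (l v : Fin 4 → Poly2) (i j : Fin 4) :
    Xi (Xi X l v i) l v j = Xi (Xi X l v j) l v i := by
  simp only [Xi, rem_rem]; congr 1; ring

theorem Xi_sub (X : Finset (ℝ × ℝ)) (l v : Fin 4 → Poly2) (i : Fin 4) : Xi X l v i ⊆ X :=
  (rem_sub _ _).trans (rem_sub _ _)

theorem mem_Xi {X : Finset (ℝ × ℝ)} {l v : Fin 4 → Poly2} {i : Fin 4} {P : ℝ × ℝ} :
    P ∈ Xi X l v i ↔ P ∈ X ∧ evalPt (l i) P ≠ 0 ∧ evalPt (v i) P ≠ 0 := by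
  simp only [Xi, mem_rem]; tauto

theorem Cfg.step' {d : ℕ} {Y : Finset (ℝ × ℝ)} {l v : Fin 4 → Poly2} {s : Finset (Fin 4)}
    (h : Cfg (d+2) Y l v s) (hL : Lns l v) {i : Fin 4} (hi : i ∈ s) :
    Cfg d (Xi Y l v i) l v (s.erase i) := h.step hL hi

/-- the third line -/
structure PM (d : ℕ) (X : Finset (ℝ × ℝ)) (l v : Fin 4 → Poly2) (i j : Fin 4) (m : Poly2) : Prop where
  thr : ∀ k p, i ≠ k → i ≠ p → j ≠ k → j ≠ p → k ≠ p →
    Three (d+2) (Xi (Xi X l v i) l v j) (l k) (l p) m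
  d1 : Dj (rem (Xi X l v i) (l j)) (v j) m
  d2 : Dj (rem (Xi X l v j) (l i)) (v i) m

theorem PM.symm {d : ℕ} {X : Finset (ℝ × ℝ)} {l v : Fin 4 → Poly2} {i j : Fin 4} {m : Poly2}
    (h : PM d X l v i j m) : PM d X l v j i m :=
  ⟨fun k p h1 h2 h3 h4 h5 => Xi_comm X l v i j ▸ h.thr k p h3 h4 h1 h2 h5, h.d2, h.d1⟩

section six
variable {d : ℕ} {X : Finset (ℝ × ℝ)} {l v : Fin 4 → Poly2}

include hN in
theorem six_T (hd : d + 6 ≤ N) (h : Quad (d+5) X l v) (ih : ∀ X l v, Quad (d+4) X l v → False)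
    {i j k p : Fin 4} (ij : i ≠ j) (ik : i ≠ k) (ip : i ≠ p) (jk : j ≠ k) (jp : j ≠ p) (kp : k ≠ p) :
    Three (d+4) (Xi X l v i) (l k) (l p) (l j) := by
  have hL := h.lns
  have hc := h.cfg.step' hL (Finset.mem_univ i)
  have hme : ∀ x, i ≠ x → x ∈ Finset.univ.erase i := by intro x hx; simp [hx.symm]
  refine ⟨hc.gc, hc.hl k (hme k ik), hc.hl p (hme p ip), hc.hl j (hme j ij), hL.ll k p kp,
    hL.ll k j jk.symm, hL.ll p j jp.symm, ?_⟩
  intro w hw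
  by_contra hcon
  push Not at hcon
  have hwl : ∀ x, i ≠ x → ¬ l x ∣ w := by
    intro x hx
    rcases fin4_cases i j k p ij ik ip jk jp kp x with rfl | rfl | rfl | rfl
    · exact absurd rfl hx
    · exact hcon.2.2
    · exact hcon.1
    · exact hcon.2.1
  have g1 := rem_GC h.gc (h.hl i)
  have m1 : ∀ x, i ≠ x → Mx (d+5) (rem X (l i)) (l x) := fun x hx =>
    P6 h.gc (h.hl i) (h.hl x) (h.ll i x hx)
  have hwv : ¬ v i ∣ w := not_dvd_rem (h.hv i).1 hw
  have hall : ∀ e, Mx (d+5) (rem X (l i)) e → v i ∣ e ∨ ∃ x, i ≠ x ∧ l x ∣ e := by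
    intro e he
    rcases P7 h.gc he with h1 | h1
    · right
      obtain ⟨x, hx⟩ := h.all e h1
      refine ⟨x, ?_, hx⟩
      rintro rfl
      exact not_dvd_rem (h.hl i).1 he hx
    · by_contra hc2
      push Not at hc2
      exact CG h.gc (h.hl i) (h.hv i) he (m1 j ij) hc2.1 (hL.vl i j)
        (nd_symm (h.hl j).1 he.1 (hc2.2 j ij)) (h.dj i) h1
  have hdw : Dj (rem X (l i)) (v i) w := by
    refine (P7 g1 hw).resolve_left fun h1 => ?_
    rcases hall w h1 with h2 | ⟨x, hx, h2⟩
    · exact hwv h2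
    · exact hwl x hx h2
  apply ih (rem X (l i)) (Function.update l i (v i)) (Function.update v i w)
  refine ⟨g1, ?_, ?_, ?_, ?_, ?_⟩
  · intro x
    by_cases hx : x = i
    · subst hx; simpa using h.hv x
    · rw [Function.update_of_ne hx]; exact m1 x (Ne.symm hx)
  · intro x y hxy
    by_cases hx : x = i
    · subst hx
      rw [Function.update_self, Function.update_of_ne hxy.symm]; exact hL.vl x y
    · by_cases hy : y = i
      · subst hy
        rw [Function.update_self, Function.update_of_ne hx]; exact hL.lv x y
      · rw [Function.update_of_ne hx, Function.update_of_ne hy]; exact h.ll x y hxy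
  · intro e he
    rcases hall e he with h1 | ⟨x, hx, h1⟩
    · exact ⟨i, by simpa using h1⟩
    · exact ⟨x, by rw [Function.update_of_ne hx.symm]; exact h1⟩
  · intro x
    by_cases hx : x = i
    · subst hx; rw [Function.update_self, Function.update_self]; exact hw
    · rw [Function.update_of_ne hx, Function.update_of_ne hx, rem_comm]
      exact P6 (rem_GC h.gc (h.hl x)) (P6 h.gc (h.hl x) (h.hl i) (h.ll x i hx)) (h.hv x) (hL.lv i x)
  · intro x
    by_cases hx : x = i
    · subst hx; simpa using hdw
    · rw [Function.update_of_ne hx, Function.update_of_ne hx]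
      exact (h.dj x).sub (rem_sub _ _)

include hN in
theorem six_B (hd : d + 6 ≤ N) (h : Quad (d+5) X l v) (ih : ∀ X l v, Quad (d+4) X l v → False)
    {i j k p : Fin 4} (ij : i ≠ j) (ik : i ≠ k) (ip : i ≠ p) (jk : j ≠ k) (jp : j ≠ p) (kp : k ≠ p) :
    ∃ m, Three (d+2) (Xi (Xi X l v i) l v j) (l k) (l p) m ∧ Dj (rem (Xi X l v i) (l j)) (v j) m := by
  have hL := h.lns
  obtain ⟨w, hw, _⟩ := (six_T hN hd h ih ij ik ip jk jp kp).her hN (by omega)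
  have hc := h.cfg.step' hL (Finset.mem_univ i)
  have hv := hc.hv j (by simp [ij.symm]) (d+3) rfl
  have hwv : w ∣ v j := by
    rcases hw.all _ hv with q | q | q
    · exact absurd q (hL.lv _ _)
    · exact absurd q (hL.lv _ _)
    · exact q
  exact (hw.repl (hL.v1 j) hwv).her hN (by omega)

include hN in
theorem six_PM (hd : d + 6 ≤ N) (h : Quad (d+5) X l v) (ih : ∀ X l v, Quad (d+4) X l v → False)
    {i j : Fin 4} (ij : i ≠ j) : ∃ m, PM d X l v i j m := by
  obtain ⟨k, p, ik, ip, jk, jp, kp⟩ := fin4_others i j ij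
  obtain ⟨m, hm, hdm⟩ := six_B hN hd h ih ij ik ip jk jp kp
  obtain ⟨m', hm', hdm'⟩ := six_B hN hd h ih ij.symm jk jp ik ip kp
  rw [Xi_comm] at hm'
  have hmm : m' ∣ m := by
    rcases hm'.all _ hm.hc with q | q | q
    · exact absurd q hm.ac
    · exact absurd q hm.bc
    · exact q
  refine ⟨m, ⟨?_, hdm, ?_⟩⟩
  · intro k' p' h1 h2 h3 h4 h5
    rcases fin4_cases i j k p ij ik ip jk jp kp k' with rfl | rfl | rfl | rfl
    · exact absurd rfl h1
    · exact absurd rfl h3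
    · rcases fin4_cases i j k' p ij ik ip jk jp kp p' with rfl | rfl | rfl | rfl
      · exact absurd rfl h2
      · exact absurd rfl h4
      · exact absurd rfl h5
      · exact hm
    · rcases fin4_cases i j k k' ij ik ip jk jp kp p' with rfl | rfl | rfl | rfl
      · exact absurd rfl h2
      · exact absurd rfl h4
      · exact hm.swap
      · exact absurd rfl h5
  · intro P hP h1 h2
    exact hdm' P hP h1 ((ev_iff_of_dvd hm'.hc.1 hm.hc.1 hmm P).2 h2)

theorem six_NE (h : Quad (d+5) X l v) {i j k : Fin 4} (ij : i ≠ j) (ik : i ≠ k) (jk : j ≠ k)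
    {m m' : Poly2} (hm : PM d X l v i j m) (hm' : PM d X l v i k m') : ¬ m ∣ m' := by
  intro hdv
  have hL := h.lns
  have hc := (h.cfg.step' hL (Finset.mem_univ i)).step' hL (i := k) (by simp [ik.symm])
  obtain ⟨p, pi, pj, pk⟩ : ∃ p : Fin 4, i ≠ p ∧ j ≠ p ∧ k ≠ p := by
    clear * - ij ik jk; decide +revert
  have hT := hm'.thr j p ij pi jk.symm pk pj
  have hv := hc.hv j (by simp [jk, ij.symm]) (d+1) rfl
  have hmm := P6 hT.gc hT.ha hT.hc hT.ac
  have : ∃ P ∈ rem (Xi (Xi X l v i) l v k) (l j), evalPt (v j) P = 0 ∧ evalPt m' P = 0 := by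
    by_cases q : v j ∣ m'
    · obtain ⟨P, hP, h1⟩ := mx_nonempty hv
      exact ⟨P, hP, h1, ev_dvd q h1⟩
    · exact P4' (rem_GC hT.gc hT.ha) hv hmm q
  obtain ⟨P, hP, h1, h2⟩ := this
  refine hm.d1 P ?_ h1 ((ev_iff_of_dvd (hm.thr k p ik pi jk pj pk).hc.1 hT.hc.1 hdv P).2 h2)
  have h3 := mem_rem.1 hP
  exact mem_rem.2 ⟨Xi_sub _ _ _ _ h3.1, h3.2⟩

theorem six_vm (h : Quad (d+5) X l v) {i j k p : Fin 4} (ik : i ≠ k) (ip : i ≠ p)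
    (jk : j ≠ k) (jp : j ≠ p) (kp : k ≠ p) {m : Poly2} (hm : PM d X l v i j m) : ¬ v k ∣ m := by
  intro hdv
  have hT := hm.thr k p ik ip jk jp kp
  obtain ⟨P, hP, h1, h2⟩ := P4 hT.gc hT.ha hT.hc hT.ac
  exact h.dj k P (Xi_sub _ _ _ _ (Xi_sub _ _ _ _ hP)) h1
    ((ev_iff_of_dvd (h.hv k).1 hT.hc.1 hdv P).2 h2)

theorem six_max (h : Quad (d+5) X l v) {i j k p : Fin 4} (ij : i ≠ j) (ik : i ≠ k) (ip : i ≠ p)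
    (jk : j ≠ k) (jp : j ≠ p) (kp : k ≠ p) {m : Poly2} (hm : PM d X l v i j m) :
    Mx (d+1) (rem (Xi (Xi X l v i) l v j) (l k)) m ∧ Mx d (Xi (Xi (Xi X l v i) l v j) l v k) m := by
  have hL := h.lns
  have hc := (h.cfg.step' hL (Finset.mem_univ i)).step' hL (i := j) (by simp [ij.symm])
  have hT := hm.thr k p ik ip jk jp kp
  have hv := hc.hv k (by simp [jk.symm, ik.symm]) (d+1) rfl
  have hmm := P6 hT.gc hT.ha hT.hc hT.ac
  exact ⟨hmm, P6 (rem_GC hT.gc hT.ha) hv hmm (six_vm h ik ip jk jp kp hm)⟩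
end six

include hN in
theorem Quad.seven {e : ℕ} {X : Finset (ℝ × ℝ)} {l v : Fin 4 → Poly2} (hd : e + 7 ≤ N)
    (h : Quad (e+6) X l v) (ih : ∀ X l v, Quad (e+5) X l v → False) : False := by
  have hL := h.lns
  have ih' : ∀ X l v, Quad (e+1+4) X l v → False := ih
  have h' : Quad (e+1+5) X l v := h
  obtain ⟨a, ha⟩ := six_PM hN hd h' ih' (show (0:Fin 4) ≠ 1 by decide)
  obtain ⟨b, hb⟩ := six_PM hN hd h' ih' (show (0:Fin 4) ≠ 2 by decide)
  obtain ⟨c, hc⟩ := six_PM hN hd h' ih' (show (1:Fin 4) ≠ 2 by decide)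
  have ab := six_NE h' (by decide) (by decide) (by decide) ha hb
  have ac := six_NE h' (by decide) (by decide) (by decide) ha.symm hc
  have bc := six_NE h' (by decide) (by decide) (by decide) hb.symm hc.symm
  have ma := (six_max h' (k := 2) (p := 3) (by decide) (by decide) (by decide) (by decide) (by decide) (by decide) ha).2
  have mb := (six_max h' (k := 1) (p := 3) (by decide) (by decide) (by decide) (by decide) (by decide) (by decide) hb).2
  have mc := (six_max h' (k := 0) (p := 3) (by decide) (by decide) (by decide) (by decide) (by decide) (by decide) hc).2
  rw [Xi_comm _ _ _ 2 1] at mb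
  rw [Xi_comm _ _ _ 2 0, Xi_comm _ _ _ 1 0] at mc
  have hT := ha.thr 3 2 (by decide) (by decide) (by decide) (by decide) (by decide)
  have hTb := hb.thr 3 1 (by decide) (by decide) (by decide) (by decide) (by decide)
  have hTc := hc.thr 3 0 (by decide) (by decide) (by decide) (by decide) (by decide)
  obtain ⟨w, hw, _⟩ := hT.swap.rot.swap.her hN (by omega)
  have hcf := (h.cfg.step' hL (Finset.mem_univ 0)).step' hL (i := 1) (by decide)
  have hv := hcf.hv 2 (by decide) (e+2) rfl
  have hwv : w ∣ v 2 := by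
    rcases hw.all _ hv with q | q | q
    · exact absurd q (nd_symm (hL.v1 2) hT.hc.1 (six_vm h' (p := 3) (by decide) (by decide) (by decide) (by decide) (by decide) ha))
    · exact absurd q (hL.lv _ _)
    · exact q
  obtain ⟨w', hw', _⟩ := (hw.repl (hL.v1 2) hwv).her hN (by omega)
  have q1 : w' ∣ b := by
    rcases hw'.all _ mb with q | q | q
    · exact absurd q ab
    · exact absurd q hTb.ac
    · exact q
  have q2 : w' ∣ c := by
    rcases hw'.all _ mc with q | q | q
    · exact absurd q ac
    · exact absurd q hTc.ac
    · exact q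
  exact bc ((dvd_symm_line hw'.hc.1 mb.1 q1).trans q2)
end


theorem fin4_erase (i j k p : Fin 4) (ij : i ≠ j) (ik : i ≠ k) (ip : i ≠ p) (jk : j ≠ k) (jp : j ≠ p)
    (kp : k ≠ p) : (Finset.univ.erase p : Finset (Fin 4)) = {i, j, k} := by
  decide +revert

theorem fin4_triple (p : Fin 4) : ∃ i j k : Fin 4, i ≠ j ∧ i ≠ k ∧ i ≠ p ∧ j ≠ k ∧ j ≠ p ∧ k ≠ p := by
  decide +revert

theorem Xi3 (X : Finset (ℝ × ℝ)) (l v : Fin 4 → Poly2) {i j k p : Fin 4} (ij : i ≠ j) (ik : i ≠ k)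
    (ip : i ≠ p) (jk : j ≠ k) (jp : j ≠ p) (kp : k ≠ p) :
    Xi (Xi (Xi X l v i) l v j) l v k = rem X (∏ x ∈ Finset.univ.erase p, l x * v x) := by
  rw [fin4_erase i j k p ij ik ip jk jp kp, Finset.prod_insert (by simp [ij, ik]),
    Finset.prod_insert (by simp [jk]), Finset.prod_singleton]
  simp only [Xi, rem_rem]
  congr 1; ring

theorem six_E {X : Finset (ℝ × ℝ)} {l v : Fin 4 → Poly2} (h : Quad 5 X l v) :
    ∃ e : Fin 4 → ℝ × ℝ, (∀ i j k p : Fin 4, i ≠ j → i ≠ k → i ≠ p → j ≠ k → j ≠ p → k ≠ p →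
      Xi (Xi (Xi X l v i) l v j) l v k = {e p}) ∧
      (∀ p, evalPt (l p) (e p) = 0) ∧ (∀ p x, x ≠ p → evalPt (l x) (e p) ≠ 0) ∧
      (∀ p x, evalPt (v x) (e p) ≠ 0) := by
  have hL := h.lns
  have h1 : ∀ p, ∃ P, rem X (∏ x ∈ Finset.univ.erase p, l x * v x) = {P} ∧ evalPt (l p) P = 0 := by
    intro p
    obtain ⟨i, j, k, ij, ik, ip, jk, jp, kp⟩ := fin4_triple p
    have hc := ((h.cfg.step' hL (Finset.mem_univ i)).step' hL (i := j) (by simp [ij.symm])).step' hL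
      (i := k) (by simp [ik.symm, jk.symm])
    have m := hc.hl p (by simp [ip.symm, jp.symm, kp.symm])
    obtain ⟨P, hP⟩ := card_zero hc.gc
    obtain ⟨Q, hQ, h1⟩ := mx_nonempty m
    rw [hP, Finset.mem_singleton] at hQ
    subst hQ
    exact ⟨Q, by rw [← Xi3 X l v ij ik ip jk jp kp]; exact hP, h1⟩
  choose e he hle using h1
  have hm : ∀ p, e p ∈ rem X (∏ x ∈ Finset.univ.erase p, l x * v x) := by
    intro p; rw [he]; simp
  have hn : ∀ p x, x ≠ p → evalPt (l x) (e p) ≠ 0 ∧ evalPt (v x) (e p) ≠ 0 := by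
    intro p x hx
    have := (mem_rem.1 (hm p)).2
    rw [ev_prod, Finset.prod_ne_zero_iff] at this
    have := this x (by simp [hx])
    rw [ev_mul] at this
    exact ⟨left_ne_zero_of_mul this, right_ne_zero_of_mul this⟩
  refine ⟨e, ?_, hle, fun p x hx => (hn p x hx).1, ?_⟩
  · intro i j k p ij ik ip jk jp kp
    rw [Xi3 X l v ij ik ip jk jp kp, he]
  · intro p x
    by_cases hx : x = p
    · subst hx
      exact h.dj x _ (rem_sub _ _ (hm x)) (hle x)
    · exact (hn p x hx).2

theorem six_O {X : Finset (ℝ × ℝ)} {l v : Fin 4 → Poly2} (h : Quad 5 X l v) {i j k p : Fin 4}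
    (ij : i ≠ j) (ik : i ≠ k) (ip : i ≠ p) (jk : j ≠ k) (jp : j ≠ p) (kp : k ≠ p) {m : Poly2}
    (hm : PM 0 X l v i j m) : ∃ O, evalPt (v k) O = 0 ∧ evalPt (v p) O = 0 ∧ evalPt m O = 0 := by
  have hL := h.lns
  have hc := (h.cfg.step' hL (Finset.mem_univ i)).step' hL (i := j) (by simp [ij.symm])
  have hk : k ∈ (Finset.univ.erase i).erase j := by simp [jk.symm, ik.symm]
  have hp : p ∈ (Finset.univ.erase i).erase j := by simp [jp.symm, ip.symm]
  have vk := hc.hv k hk 1 rfl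
  have vp := hc.hv p hp 1 rfl
  have lk := P6 hc.gc (hc.hl p hp) (hc.hl k hk) (hL.ll p k kp.symm)
  have lp := P6 hc.gc (hc.hl k hk) (hc.hl p hp) (hL.ll k p kp)
  have gk := rem_GC hc.gc (hc.hl k hk)
  have gp := rem_GC hc.gc (hc.hl p hp)
  have a1 := P6 gk lp vk (hL.lv p k)
  have a2 := P6 gp lk vp (hL.lv k p)
  rw [rem_comm] at a2
  have a3 := P6 gk lp (six_max h ij ik ip jk jp kp hm).1 (hm.thr k p ik ip jk jp kp).bc
  obtain ⟨P, hP⟩ := card_zero (rem_GC gk lp)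
  have on : ∀ x, Mx 0 (rem (rem (Xi (Xi X l v i) l v j) (l k)) (l p)) x → evalPt x P = 0 := by
    intro x hx
    obtain ⟨Q, hQ, h1⟩ := mx_nonempty hx
    rw [hP, Finset.mem_singleton] at hQ
    rw [← hQ]; exact h1
  exact ⟨P, on _ a1, on _ a2, on _ a3⟩

theorem det_fact (n : Fin 4 → Fin 4 → ℝ) (hn : ∀ i j, n i j ≠ 0)
    (h2 : ∀ i j, i ≠ j → n i i * n j j = n i j * n j i)
    (A B K x y : Fin 4 → ℝ) (hA : ∀ i j, n i j = A i * x j + B i * y j + K i) :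
    ∃ i j k : Fin 4, i ≠ j ∧ i ≠ k ∧ j ≠ k ∧ n i j * n j k * n k i = n i i * n j j * n k k := by
  by_contra hcon
  push Not at hcon
  have c1 := hcon 0 1 2 (by decide) (by decide) (by decide)
  have c2 := hcon 0 1 3 (by decide) (by decide) (by decide)
  have c3 := hcon 0 2 3 (by decide) (by decide) (by decide)
  have c4 := hcon 1 2 3 (by decide) (by decide) (by decide)
  have hdet : (Matrix.of n).det = 0 := by
    have : (Matrix.of n) = (Matrix.of fun i (j : Fin 3) => ![A i, B i, K i] j) *
        (Matrix.of fun (j : Fin 3) i => ![x i, y i, 1] j) := by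
      ext i j
      simp [Matrix.mul_apply, Fin.sum_univ_three, hA]
    rw [this]
    by_contra hd
    have hu : IsUnit ((Matrix.of fun i (j : Fin 3) => ![A i, B i, K i] j) *
        (Matrix.of fun (j : Fin 3) i => ![x i, y i, 1] j) : Matrix (Fin 4) (Fin 4) ℝ) :=
      (Matrix.isUnit_iff_isUnit_det _).2 (isUnit_iff_ne_zero.2 hd)
    have r := Matrix.rank_of_isUnit _ hu
    have r2 := Matrix.rank_mul_le_left (Matrix.of fun i (j : Fin 3) => ![A i, B i, K i] j)
        (Matrix.of fun (j : Fin 3) i => ![x i, y i, 1] j)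
    have r3 := Matrix.rank_le_width (Matrix.of fun (i : Fin 4) (j : Fin 3) => ![A i, B i, K i] j)
    simp at r
    omega
  have n10 : n 1 0 = n 0 0 * n 1 1 / n 0 1 := by
    rw [h2 0 1 (by decide)]; field_simp [hn 0 1]
  have n20 : n 2 0 = n 0 0 * n 2 2 / n 0 2 := by
    rw [h2 0 2 (by decide)]; field_simp [hn 0 2]
  have n30 : n 3 0 = n 0 0 * n 3 3 / n 0 3 := by
    rw [h2 0 3 (by decide)]; field_simp [hn 0 3]
  have n21 : n 2 1 = n 1 1 * n 2 2 / n 1 2 := by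
    rw [h2 1 2 (by decide)]; field_simp [hn 1 2]
  have n31 : n 3 1 = n 1 1 * n 3 3 / n 1 3 := by
    rw [h2 1 3 (by decide)]; field_simp [hn 1 3]
  have n32 : n 3 2 = n 2 2 * n 3 3 / n 2 3 := by
    rw [h2 2 3 (by decide)]; field_simp [hn 2 3]
  have k01 := hn 0 1
  have k02 := hn 0 2
  have k03 := hn 0 3
  have k12 := hn 1 2
  have k13 := hn 1 3
  have k23 := hn 2 3
  have k00 := hn 0 0
  have k11 := hn 1 1
  have k22 := hn 2 2
  have k33 := hn 3 3
  rw [n20] at c1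
  rw [n30] at c2 c3
  rw [n31] at c4
  simp only [Matrix.det_succ_row_zero, Fin.sum_univ_succ, Matrix.of_apply, Matrix.submatrix_apply, Fin.succAbove] at hdet
  simp at hdet
  rw [n10, n20, n30, n21, n31, n32] at hdet
  generalize n 0 0 = p at *
  generalize n 1 1 = q at *
  generalize n 2 2 = r at *
  generalize n 3 3 = s at *
  generalize n 0 1 = a at *
  generalize n 0 2 = b at *
  generalize n 0 3 = c at *
  generalize n 1 2 = d at *
  generalize n 1 3 = e at *
  generalize n 2 3 = f at *
  have hd' : p * s * (a*d-q*b)*(a*e-q*c)*(b*f-r*c)*(r*e-d*f)/(a*b*c*d*e*f) = 0 := by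
    rw [← hdet]; field_simp; ring
  have d1 : a*d-q*b ≠ 0 := by
    intro h; apply c1; field_simp; linear_combination h
  have d2 : a*e-q*c ≠ 0 := by
    intro h; apply c2; field_simp; linear_combination h
  have d3 : b*f-r*c ≠ 0 := by
    intro h; apply c3; field_simp; linear_combination h
  have d4 : r*e-d*f ≠ 0 := by
    intro h; apply c4; field_simp; linear_combination -h
  refine absurd hd' ?_
  positivity

section
variable {N : ℕ} (hN : GMU N)
include hN in
theorem Quad.six {X : Finset (ℝ × ℝ)} {l v : Fin 4 → Poly2} (hd : 6 ≤ N) (h : Quad 5 X l v) : False := by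
  have hL := h.lns
  have ih : ∀ X l v, Quad (0+4) X l v → False := fun X l v h => h.five
  have h' : Quad (0+5) X l v := h
  obtain ⟨e, he, hle, hlne, hv⟩ := six_E h
  have hdis : ∀ i j, i ≠ j → e i ≠ e j := by
    intro i j hij h1
    exact hlne j i hij (h1 ▸ hle i)
  have hm : ∀ i j : Fin 4, i ≠ j → ∃ m, PM 0 X l v i j m := fun i j ij => six_PM hN hd h' ih ij
  have hme : ∀ i j k p m, i ≠ j → i ≠ k → i ≠ p → j ≠ k → j ≠ p → k ≠ p → PM 0 X l v i j m →
      evalPt m (e p) = 0 ∧ Ln m := by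
    intro i j k p m ij ik ip jk jp kp hm
    have m1 := (six_max h' ij ik ip jk jp kp hm).2
    obtain ⟨Q, hQ, h1⟩ := mx_nonempty m1
    rw [he i j k p ij ik ip jk jp kp, Finset.mem_singleton] at hQ
    exact ⟨hQ ▸ h1, m1.1⟩
  have wdeg : ∀ (c c' : ℝ) i j, (C c * v i - C c' * v j : Poly2).totalDegree ≤ 1 := by
    intro c c' i j
    refine (totalDegree_sub _ _).trans (max_le ?_ ?_)
    · refine (totalDegree_mul _ _).trans ?_
      rw [totalDegree_C, hL.v1]
    · refine (totalDegree_mul _ _).trans ?_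
      rw [totalDegree_C, hL.v1]
  have wev : ∀ (c c' : ℝ) i j P, evalPt (C c * v i - C c' * v j) P = c * evalPt (v i) P - c' * evalPt (v j) P := by
    intro c c' i j P
    rw [ev_sub, ev_mul, ev_mul, ev_C, ev_C]
  have hw : ∀ i j k p m, i ≠ j → i ≠ k → i ≠ p → j ≠ k → j ≠ p → k ≠ p → PM 0 X l v k p m →
      m ∣ C (evalPt (v j) (e j)) * v i - C (evalPt (v i) (e j)) * v j := by
    intro i j k p m ij ik ip jk jp kp hm
    obtain ⟨O, o1, o2, o3⟩ := six_O h kp ik.symm jk.symm ip.symm jp.symm ij hm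
    obtain ⟨m1, hml⟩ := hme k p i j m kp ik.symm jk.symm ip.symm jp.symm ij hm
    refine two_pts hml (wdeg _ _ _ _) (P := e j) (Q := O) ?_ m1 o3 ?_ ?_
    · intro h1
      rw [← h1] at o1
      exact hv _ _ o1
    · rw [wev]; ring
    · rw [wev, o1, o2]; ring
  have h2 : ∀ i j, i ≠ j → evalPt (v i) (e i) * evalPt (v j) (e j) = evalPt (v i) (e j) * evalPt (v j) (e i) := by
    intro i j ij
    obtain ⟨k, p, ik, ip, jk, jp, kp⟩ := fin4_others i j ij
    obtain ⟨m, hmm⟩ := hm k p kp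
    have := ev_dvd (hw i j k p m ij ik ip jk jp kp hmm) (hme k p j i m kp jk.symm ik.symm jp.symm ip.symm ij.symm hmm).1
    rw [wev] at this
    linear_combination this
  obtain ⟨i, j, k, ij, ik, jk, h3⟩ := det_fact (fun i j => evalPt (v i) (e j)) (fun i j => hv j i) h2
    (fun i => cfa (v i)) (fun i => cfb (v i)) (fun i => cfk (v i)) (fun i => (e i).1) (fun i => (e i).2)
    (fun i j => ev_affine _ (hL.v1 i).le _)
  obtain ⟨p, ip, jp, kp⟩ : ∃ p : Fin 4, i ≠ p ∧ j ≠ p ∧ k ≠ p := by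
    clear * - ij ik jk; decide +revert
  obtain ⟨m, hmm⟩ := hm p k kp.symm
  obtain ⟨m', hmm'⟩ := hm p j jp.symm
  have hne := six_NE h' kp.symm jp.symm jk.symm hmm hmm'
  have d1 := hw i j k p m ij ik ip jk jp kp hmm.symm
  have e1 := hme p j k i m' jp.symm kp.symm ip.symm jk ij.symm ik.symm hmm'
  have e2 := hme p j i k m' jp.symm ip.symm kp.symm ij.symm jk ik hmm'
  have d2 : m' ∣ C (evalPt (v j) (e j)) * v i - C (evalPt (v i) (e j)) * v j := by
    refine two_pts e1.2 (wdeg _ _ _ _) (hdis i k ik) e1.1 e2.1 ?_ ?_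
    · rw [wev]; linear_combination h2 i j ij
    · rw [wev]
      have z1 := h2 i k ik
      have z2 := hv i k
      refine mul_left_cancel₀ z2 ?_
      linear_combination -h3 - evalPt (v j) (e j) * z1
  have ml := (hme p k j i m kp.symm jp.symm ip.symm jk.symm ik.symm ij.symm hmm).2
  have w0 : C (evalPt (v j) (e j)) * v i - C (evalPt (v i) (e j)) * v j = 0 := by
    by_contra w0
    obtain ⟨q, hq⟩ := d1
    rw [hq] at d2
    rcases e1.2.prime.dvd_or_dvd d2 with d3 | d3
    · exact hne (dvd_symm_line e1.2 ml d3)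
    · have := wdeg (evalPt (v j) (e j)) (evalPt (v i) (e j)) i j
      obtain ⟨q', rfl⟩ := d3
      rw [hq] at this w0
      rw [totalDegree_mul_of_isDomain (left_ne_zero_of_mul w0) (right_ne_zero_of_mul w0),
        totalDegree_mul_of_isDomain (left_ne_zero_of_mul (right_ne_zero_of_mul w0))
        (right_ne_zero_of_mul (right_ne_zero_of_mul w0)), ml, e1.2] at this
      omega
  have : v i ∣ C (evalPt (v i) (e j)) * v j := ⟨C (evalPt (v j) (e j)), by linear_combination -w0⟩
  exact hL.vv i j ij ((C_dvd (hv j i)).1 this)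

include hN in
theorem Quad.none (D : ℕ) (hd : D + 5 ≤ N) (X : Finset (ℝ × ℝ)) (l v : Fin 4 → Poly2) (h : Quad (D+4) X l v) : False := by
  induction D using Nat.strong_induction_on generalizing X l v with
  | _ D ih =>
    match D, ih with
    | 0, _ => exact h.five
    | 1, _ => exact Quad.six hN (by omega) h
    | e+2, ih => exact Quad.seven hN (by omega) h (fun X l v h => ih (e+1) (by omega) (by omega) X l v h)
end


/-! ### Reductions -/

inductive Red (ℓ : Poly2) : ℕ → Finset (ℝ × ℝ) → ℕ → Finset (ℝ × ℝ) → Poly2 → Prop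
  | base (n : ℕ) (X : Finset (ℝ × ℝ)) (hX : IsGC n X) : Red ℓ n X n X 1
  | step (n : ℕ) (X : Finset (ℝ × ℝ)) (a : Poly2) (m : ℕ) (X' : Finset (ℝ × ℝ)) (G : Poly2)
      (hX : IsGC (n+1) X) (ha : Mx (n+1) X a) (hla : ¬ ℓ ∣ a)
      (hu : ∀ A ∈ usesSet (n+1) X ℓ, evalPt a A ≠ 0) (hr : Red ℓ n (rem X a) m X' G) :
      Red ℓ (n+1) X m X' (a * G)

section
variable {ℓ G : Poly2} {n m : ℕ} {X X' : Finset (ℝ × ℝ)}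

theorem Red.gc (h : Red ℓ n X m X' G) : IsGC n X := by
  cases h <;> assumption

theorem Red.gc' (h : Red ℓ n X m X' G) : IsGC m X' := by
  induction h <;> assumption

theorem Red.sub (h : Red ℓ n X m X' G) : X' ⊆ X := by
  induction h with
  | base => exact fun _ h => h
  | step n X a m X' G hX ha hla hu hr ih => exact ih.trans (rem_sub _ _)

theorem Red.deg (h : Red ℓ n X m X' G) : G.totalDegree + m ≤ n := by
  induction h with
  | base => simp
  | step n X a m X' G hX ha hla hu hr ih =>
    have := totalDegree_mul a G
    rw [ha.1] at this
    omega

theorem Red.uses (hl : Ln ℓ) (h : Red ℓ n X m X' G) : usesSet m X' ℓ = usesSet n X ℓ := by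
  induction h with
  | base => rfl
  | step n X a m X' G hX ha hla hu hr ih =>
    rw [ih, uses_rem hX ha hl hla]
    ext A
    rw [mem_rem]
    exact ⟨fun h => h.1, fun h => ⟨h, hu A h⟩⟩

theorem Red.ne (h : Red ℓ n X m X' G) {P : ℝ × ℝ} (hP : P ∈ X) : evalPt G P ≠ 0 ↔ P ∈ X' := by
  induction h with
  | base => simp [ev_one, hP]
  | step n X a m X' G hX ha hla hu hr ih =>
    rw [ev_mul, mul_ne_zero_iff]
    constructor
    · rintro ⟨h1, h2⟩
      exact (ih (mem_rem.2 ⟨hP, h1⟩)).1 h2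
    · intro h1
      have h2 := hr.sub h1
      exact ⟨(mem_rem.1 h2).2, (ih h2).2 h1⟩

theorem Red.nd (hl : Ln ℓ) (h : Red ℓ n X m X' G) : ¬ ℓ ∣ G := by
  induction h with
  | base => exact hl.prime.not_dvd_one
  | step n X a m X' G hX ha hla hu hr ih =>
    rw [hl.prime.dvd_mul]; tauto

theorem Red.fd (h : Red ℓ n X m X' G) {A : ℝ × ℝ} (hA : A ∈ X') :
    ∃ c : ℝ, c ≠ 0 ∧ fd n X A = C c * (G * fd m X' A) := by
  induction h with
  | base => exact ⟨1, one_ne_zero, by simp⟩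
  | step n X a m X' G hX ha hla hu hr ih =>
    obtain ⟨c, hc, h1⟩ := ih hA
    have h2 := hr.sub hA
    refine ⟨(evalPt a A)⁻¹ * c, mul_ne_zero (inv_ne_zero (mem_rem.1 h2).2) hc, ?_⟩
    rw [fd_rem hX ha h2, h1, C_mul]
    ring

theorem Red.mx (h : Red ℓ n X m X' G) {b : Poly2} (hb : Mx n X b) :
    (∀ P ∈ X', evalPt b P ≠ 0) ∨ Mx m X' b := by
  induction h with
  | base => exact Or.inr hb
  | step n X a m X' G hX ha hla hu hr ih =>
    by_cases hd : a ∣ b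
    · left
      intro P hP h1
      exact (mem_rem.1 (hr.sub hP)).2 ((ev_iff_of_dvd ha.1 hb.1 hd P).2 h1)
    · exact ih (P6 hX ha hb hd)

structure Sol (ℓ : Poly2) (n : ℕ) (X : Finset (ℝ × ℝ)) (m : ℕ) (X' : Finset (ℝ × ℝ)) (G : Poly2) : Prop where
  hl : Ln ℓ
  red : Red ℓ n X (m+1) X' G
  mx : Mx (m+1) X' ℓ

theorem Sol.uses (h : Sol ℓ n X m X' G) : usesSet n X ℓ = rem X' ℓ := by
  rw [← h.red.uses h.hl]
  ext A
  rw [mem_uses h.red.gc', mem_rem]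
  exact ⟨fun h1 => ⟨h1.1, fd_line_ne h.red.gc' h1.1 h1.2⟩,
    fun h1 => ⟨h1.1, mx_dvd_fd h.red.gc' h.mx h1.1 h1.2⟩⟩

theorem Sol.card (h : Sol ℓ n X m X' G) : (usesSet n X ℓ).card = (m+2).choose 2 := by
  rw [h.uses]
  exact (rem_GC h.red.gc' h.mx).1.1

theorem Sol.on (h : Sol ℓ n X m X' G) {b : Poly2} (hb : Mx n X b) :
    (nodesOn (usesSet n X ℓ) b).card = 0 ∨ (nodesOn (usesSet n X ℓ) b).card = m + 1 := by
  rw [h.uses]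
  have key : (∀ P ∈ rem X' ℓ, evalPt b P ≠ 0) → (nodesOn (rem X' ℓ) b).card = 0 := by
    intro h1
    rw [Finset.card_eq_zero, Finset.eq_empty_iff_forall_notMem]
    intro P hP
    exact h1 P (mem_on.1 hP).1 (mem_on.1 hP).2
  rcases h.red.mx hb with h1 | h1
  · exact Or.inl (key fun P hP => h1 P (rem_sub _ _ hP))
  · by_cases hd : ℓ ∣ b
    · left
      apply key
      intro P hP h2
      exact (mem_rem.1 hP).2 ((ev_iff_of_dvd h.hl hb.1 hd P).2 h2)
    · right
      exact (P6 h.red.gc' h.mx h1 hd).2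

theorem Sol.fd (h : Sol ℓ n X m X' G) {A : ℝ × ℝ} (hA : A ∈ rem X' ℓ) :
    ∃ c : ℝ, c ≠ 0 ∧ fd n X A = ℓ * (C c * (G * fd m (rem X' ℓ) A)) := by
  obtain ⟨c, hc, h1⟩ := h.red.fd (rem_sub _ _ hA)
  refine ⟨c * (evalPt ℓ A)⁻¹, mul_ne_zero hc (inv_ne_zero (mem_rem.1 hA).2), ?_⟩
  rw [h1, fd_rem h.red.gc' h.mx hA, C_mul]
  ring

theorem Sol.nonnull (h : Sol ℓ n X m X' G) {F : ℝ × ℝ} (hF : F ∈ X) :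
    F ∈ X' ↔ ¬ Null n X ℓ F := by
  rw [← h.red.ne hF]
  constructor
  · intro h1 h2
    have g := rem_GC h.red.gc' h.mx
    have h3 := sum_fd g
    have h4 : (1:ℝ) = ∑ D ∈ rem X' ℓ, evalPt (_root_.fd m (rem X' ℓ) D) F := by
      rw [← ev_sum, ← h3, ev_one]
    have h5 : ∑ D ∈ rem X' ℓ, evalPt (_root_.fd m (rem X' ℓ) D) F = 0 := by
      apply Finset.sum_eq_zero
      intro A hA
      obtain ⟨c, hc, h6⟩ := h.fd hA
      have h7 := h2 A (h.red.sub (rem_sub _ _ hA)) _ h6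
      rw [ev_mul, ev_mul, ev_C] at h7
      rcases mul_eq_zero.1 h7 with h8 | h8
      · exact absurd h8 hc
      · exact (mul_eq_zero.1 h8).resolve_left h1
    rw [h5] at h4
    exact one_ne_zero h4
  · intro h1 h2
    apply h1
    intro A hA g hg
    have hA' : A ∈ usesSet n X ℓ := (mem_uses h.red.gc).2 ⟨hA, ⟨g, hg⟩⟩
    rw [h.uses] at hA'
    obtain ⟨c, hc, h6⟩ := h.fd hA'
    rw [hg] at h6
    have := mul_left_cancel₀ h.hl.ne_zero h6
    rw [this, ev_mul, ev_mul, h2]; ring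
end


theorem Null.rem {n : ℕ} {X : Finset (ℝ × ℝ)} {ℓ a : Poly2} {F : ℝ × ℝ} (hX : IsGC (n+1) X) (ha : Mx (n+1) X a)
    (hF : evalPt a F ≠ 0) (h : Null (n+1) X ℓ F) : Null n (rem X a) ℓ F := by
  intro A hA g hg
  have h1 := fd_rem hX ha hA
  have h2 := h A (rem_sub _ _ hA) (C (evalPt a A)⁻¹ * (a * g)) (by rw [h1, hg]; ring)
  rw [ev_mul, ev_mul, ev_C] at h2
  rcases mul_eq_zero.1 h2 with h3 | h3
  · exact absurd h3 (inv_ne_zero (mem_rem.1 hA).2)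
  · exact (mul_eq_zero.1 h3).resolve_left hF

theorem on_rem (U : Finset (ℝ × ℝ)) (a b : Poly2) : nodesOn (rem U a) b = rem (nodesOn U b) a := by
  ext A; simp only [mem_rem, mem_on]; tauto

theorem on_on {U : Finset (ℝ × ℝ)} {a b : Poly2} (ha : Ln a) (hb : Ln b) (hab : ¬ a ∣ b) {P : ℝ × ℝ}
    (h1 : evalPt a P = 0) (h2 : evalPt b P = 0) :
    (nodesOn (nodesOn U b) a).card = if P ∈ U then 1 else 0 := by
  split_ifs with h
  · rw [Finset.card_eq_one]
    refine ⟨P, ?_⟩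
    ext A
    simp only [mem_on, Finset.mem_singleton]
    constructor
    · rintro ⟨⟨h3, h4⟩, h5⟩
      exact line_eq_pt ha hb hab h5 h1 h4 h2
    · rintro rfl; exact ⟨⟨h, h2⟩, h1⟩
  · rw [Finset.card_eq_zero, Finset.eq_empty_iff_forall_notMem]
    intro A hA
    simp only [mem_on] at hA
    apply h
    rw [← line_eq_pt ha hb hab hA.2 h1 hA.1.2 h2]
    exact hA.1.1

theorem cnt {U : Finset (ℝ × ℝ)} {a b : Poly2} (ha : Ln a) (hb : Ln b) (hab : ¬ a ∣ b) {P : ℝ × ℝ}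
    (h1 : evalPt a P = 0) (h2 : evalPt b P = 0) :
    (if P ∈ U then 1 else 0) + (nodesOn (rem U a) b).card = (nodesOn U b).card := by
  rw [on_rem, ← card_rem (nodesOn U b) a, on_on ha hb hab h1 h2]

structure Ctx (N n : ℕ) (X : Finset (ℝ × ℝ)) (ℓ : Poly2) : Prop where
  hN : GMU N
  hn : n + 2 ≤ N
  gc : IsGC (n+2) X
  hl : Ln ℓ
  nm : ¬ Mx (n+2) X ℓ
  used : ∀ a, Mx (n+2) X a → ∃ A ∈ usesSet (n+2) X ℓ, evalPt a A = 0
  ih : ∀ m ≤ n + 1, ∀ Y, IsGC m Y → (usesSet m Y ℓ).Nonempty → ∃ m' X' G, Sol ℓ m Y m' X' G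

section
variable {N n : ℕ} {X : Finset (ℝ × ℝ)} {ℓ : Poly2}

theorem Ctx.nd (c : Ctx N n X ℓ) {a : Poly2} (ha : Mx (n+2) X a) : ¬ ℓ ∣ a := fun h =>
  c.nm (Mx_dvd ha c.hl (dvd_symm_line c.hl ha.1 h))

theorem Ctx.nd' (c : Ctx N n X ℓ) {a : Poly2} (ha : Mx (n+2) X a) : ¬ a ∣ ℓ := fun h =>
  c.nm (Mx_dvd ha c.hl h)

theorem Ctx.F (c : Ctx N n X ℓ) {a : Poly2} (ha : Mx (n+2) X a) : ∃ P ∈ X, evalPt a P = 0 ∧ evalPt ℓ P = 0 := by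
  obtain ⟨A, hA, h1⟩ := c.used a ha
  obtain ⟨hA, hd⟩ := (mem_uses c.gc).1 hA
  obtain ⟨P, hP, h2, _, h3⟩ := M1x c.gc ha hA h1 c.hl hd
  exact ⟨P, hP, h2, h3⟩

theorem Ctx.Q (c : Ctx N n X ℓ) {a b e : Poly2} (h : Three (n+2) X a b e) {A : ℝ × ℝ}
    (hA : A ∈ usesSet (n+2) X ℓ) (h1 : evalPt a A = 0) (h2 : evalPt b A = 0) : False := by
  obtain ⟨hA, hd⟩ := (mem_uses c.gc).1 hA
  obtain ⟨P, hP, h3, h4⟩ := c.F h.hc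
  exact QQ c.hN (n+1) c.hn X a b e ℓ A h hA h1 h2 c.hl hd (c.nd' h.hc) P hP h3 h4

theorem Ctx.third (c : Ctx N n X ℓ) {i j : Poly2} (hi : Mx (n+2) X i) (hj : Mx (n+2) X j) :
    ∃ k, Mx (n+2) X k ∧ ¬ i ∣ k ∧ ¬ j ∣ k := by
  obtain ⟨x, y, z, hx, hy, hz, xy, xz, yz⟩ := three_max c.hN (n+1) c.hn X c.gc
  have tr : ∀ w u v, Mx (n+2) X w → Mx (n+2) X u → w ∣ u → w ∣ v → u ∣ v := fun w u v hw hu h1 h2 =>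
    (dvd_symm_line hw.1 hu.1 h1).trans h2
  by_contra hcon
  push Not at hcon
  have h1 := fun k hk => or_iff_not_imp_left.2 (hcon k hk)
  rcases h1 x hx with a | a <;> rcases h1 y hy with b | b <;> rcases h1 z hz with d | d
  · exact xy (tr i x y hi hx a b)
  · exact xy (tr i x y hi hx a b)
  · exact xz (tr i x z hi hx a d)
  · exact yz (tr j y z hj hy b d)
  · exact yz (tr i y z hi hy b d)
  · exact xz (tr j x z hj hx a d)
  · exact xy (tr j x y hj hx a b)
  · exact xy (tr j x y hj hx a b)

/-- either exactly three maximal lines or a fourth -/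
theorem Ctx.fourth (c : Ctx N n X ℓ) {i j k : Poly2} (hi : Mx (n+2) X i) (hj : Mx (n+2) X j) (hk : Mx (n+2) X k)
    (ij : ¬ i ∣ j) (ik : ¬ i ∣ k) (jk : ¬ j ∣ k) :
    Three (n+2) X i j k ∨ ∃ l, Mx (n+2) X l ∧ ¬ i ∣ l ∧ ¬ j ∣ l ∧ ¬ k ∣ l := by
  by_cases h : ∀ d, Mx (n+2) X d → i ∣ d ∨ j ∣ d ∨ k ∣ d
  · exact Or.inl ⟨c.gc, hi, hj, hk, ij, ik, jk, h⟩
  · push Not at h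
    exact Or.inr h

theorem Ctx.sol1 (c : Ctx N n X ℓ) {i : Poly2} (hi : Mx (n+2) X i)
    (hne : (rem (usesSet (n+2) X ℓ) i).Nonempty) :
    ∃ t X' G, Sol ℓ (n+1) (rem X i) t X' G ∧ (rem (usesSet (n+2) X ℓ) i).card = (t+2).choose 2 ∧
      ∀ j, Mx (n+2) X j → ¬ i ∣ j → (nodesOn (rem (usesSet (n+2) X ℓ) i) j).card = 0 ∨
        (nodesOn (rem (usesSet (n+2) X ℓ) i) j).card = t + 1 := by
  have hu := uses_rem c.gc hi c.hl (c.nd hi)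
  obtain ⟨t, X', G, h⟩ := c.ih (n+1) le_rfl (rem X i) (rem_GC c.gc hi) (by rw [hu]; exact hne)
  refine ⟨t, X', G, h, ?_, ?_⟩
  · rw [← hu]; exact h.card
  · intro j hj hij
    rw [← hu]; exact h.on (P6 c.gc hi hj hij)

theorem Ctx.sol2 (c : Ctx N n X ℓ) {i k : Poly2} (hi : Mx (n+2) X i) (hk : Mx (n+2) X k) (hik : ¬ i ∣ k)
    (hne : (rem (rem (usesSet (n+2) X ℓ) i) k).Nonempty) :
    ∃ t X' G, Sol ℓ n (rem (rem X i) k) t X' G ∧ (rem (rem (usesSet (n+2) X ℓ) i) k).card = (t+2).choose 2 ∧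
      ∀ j, Mx (n+2) X j → ¬ i ∣ j → ¬ k ∣ j → (nodesOn (rem (rem (usesSet (n+2) X ℓ) i) k) j).card = 0 ∨
        (nodesOn (rem (rem (usesSet (n+2) X ℓ) i) k) j).card = t + 1 := by
  have hu := uses_rem c.gc hi c.hl (c.nd hi)
  have g1 := rem_GC c.gc hi
  have mk := P6 c.gc hi hk hik
  have hu2 := uses_rem g1 mk c.hl (c.nd hk)
  rw [hu] at hu2
  obtain ⟨t, X', G, h⟩ := c.ih n (by omega) (rem (rem X i) k) (rem_GC g1 mk) (by rw [hu2]; exact hne)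
  refine ⟨t, X', G, h, ?_, ?_⟩
  · rw [← hu2]; exact h.card
  · intro j hj hij hkj
    rw [← hu2]; exact h.on (P6 g1 mk (P6 c.gc hi hj hij) hkj)

theorem tri_succ (t : ℕ) : (t+2).choose 2 = (t+1).choose 2 + (t+1) := by
  rw [Nat.choose_succ_succ' (t+1) 1, Nat.choose_one_right]; ring

theorem tri_inj {s t : ℕ} (h : (s+2).choose 2 = (t+2).choose 2) : s = t := by
  have mono : ∀ {a b : ℕ}, a < b → (a+2).choose 2 < (b+2).choose 2 := by
    intro a b hab
    have : (a+3).choose 2 ≤ (b+2).choose 2 := Nat.choose_le_choose 2 (by omega)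
    have h2 := tri_succ (a+1)
    have h3 : (a+1+2).choose 2 = (a+3).choose 2 := rfl
    have h4 : (a+1+1).choose 2 = (a+2).choose 2 := rfl
    omega
  rcases lt_trichotomy s t with h1 | h1 | h1
  · have := mono h1; omega
  · exact h1
  · have := mono h1; omega

/-- the users do not lie on one maximal line -/
theorem Ctx.S1 (c : Ctx N n X ℓ) {i : Poly2} (hi : Mx (n+2) X i) : (rem (usesSet (n+2) X ℓ) i).Nonempty := by
  by_contra hne
  rw [Finset.not_nonempty_iff_eq_empty] at hne
  have hsub : ∀ A ∈ usesSet (n+2) X ℓ, evalPt i A = 0 := by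
    intro A hA
    by_contra h
    have : A ∈ rem (usesSet (n+2) X ℓ) i := mem_rem.2 ⟨hA, h⟩
    rw [hne] at this; simp at this
  obtain ⟨j, hj, ij, _⟩ := c.third hi hi
  obtain ⟨k, hk, ik, jk⟩ := c.third hi hj
  obtain ⟨B, hB, B1⟩ := c.used j hj
  rcases c.fourth hi hj hk ij ik jk with h | ⟨l, hl, il, jl, kl⟩
  · exact c.Q h hB (hsub B hB) B1
  · obtain ⟨D, hD, D1⟩ := c.used k hk
    obtain ⟨E, hE, E1⟩ := c.used l hl
    have Dj : evalPt j D ≠ 0 := P5 c.gc hi hk hj ik ij (nd_symm hj.1 hk.1 jk) (hsub D hD) D1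
    have Ej : evalPt j E ≠ 0 := P5 c.gc hi hl hj il ij (nd_symm hj.1 hl.1 jl) (hsub E hE) E1
    have DE : D ≠ E := by
      rintro rfl
      exact P5 c.gc hi hk hl ik il kl (hsub D hD) D1 E1
    have hD' : D ∈ rem (usesSet (n+2) X ℓ) j := mem_rem.2 ⟨hD, Dj⟩
    have hE' : E ∈ rem (usesSet (n+2) X ℓ) j := mem_rem.2 ⟨hE, Ej⟩
    obtain ⟨t, X', G, hs, h1, h2⟩ := c.sol1 hj ⟨D, hD'⟩
    have h3 : nodesOn (rem (usesSet (n+2) X ℓ) j) i = rem (usesSet (n+2) X ℓ) j := by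
      ext A
      rw [mem_on]
      exact ⟨fun h => h.1, fun h => ⟨h, hsub A (mem_rem.1 h).1⟩⟩
    have h4 := h2 i hi (nd_symm hi.1 hj.1 ij)
    rw [h3] at h4
    have h5 : 1 < (rem (usesSet (n+2) X ℓ) j).card := Finset.one_lt_card.2 ⟨D, hD', E, hE', DE⟩
    have h6 := tri_succ t
    cases t with
    | zero => simp at h1; omega
    | succ t =>
      have := tri_succ t
      simp only [Nat.add_assoc, Nat.reduceAdd] at *
      omega
end

section
variable {N n : ℕ} {X : Finset (ℝ × ℝ)} {ℓ : Poly2}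

theorem Ctx.pos (c : Ctx N n X ℓ) {i : Poly2} (hi : Mx (n+2) X i) : 1 ≤ (nodesOn (usesSet (n+2) X ℓ) i).card := by
  obtain ⟨A, hA, h⟩ := c.used i hi
  exact Finset.card_pos.2 ⟨A, mem_on.2 ⟨hA, h⟩⟩

theorem Ctx.S2 (c : Ctx N n X ℓ) {i j : Poly2} (hi : Mx (n+2) X i) (hj : Mx (n+2) X j) (ij : ¬ i ∣ j)
    {P : ℝ × ℝ} (h1 : evalPt i P = 0) (h2 : evalPt j P = 0) (hP : P ∉ usesSet (n+2) X ℓ) :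
    (usesSet (n+2) X ℓ).card = 2 ∧ (nodesOn (usesSet (n+2) X ℓ) i).card = 1 ∧
      (nodesOn (usesSet (n+2) X ℓ) j).card = 1 := by
  have ji := nd_symm hi.1 hj.1 ij
  obtain ⟨t, X1, G1, s1, c1, o1⟩ := c.sol1 hi (c.S1 hi)
  obtain ⟨t', X2, G2, s2, c2, o2⟩ := c.sol1 hj (c.S1 hj)
  have q1 := cnt (U := usesSet (n+2) X ℓ) hi.1 hj.1 ij h1 h2
  have q2 := cnt (U := usesSet (n+2) X ℓ) hj.1 hi.1 ji h2 h1
  rw [if_neg hP, zero_add] at q1 q2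
  have o1' := o1 j hj ij
  have o2' := o2 i hi ji
  have r1 := card_rem (usesSet (n+2) X ℓ) i
  have r2 := card_rem (usesSet (n+2) X ℓ) j
  have p1 := c.pos hi
  have p2 := c.pos hj
  have u1 := tri_succ t
  have u2 := tri_succ t'
  have e1 : (nodesOn (usesSet (n+2) X ℓ) j).card = t + 1 := by omega
  have e2 : (nodesOn (usesSet (n+2) X ℓ) i).card = t' + 1 := by omega
  have tt : t = t' := by
    have h3 : (t+1).choose 2 = (t'+1).choose 2 := by omega
    rcases t with _ | t <;> rcases t' with _ | t'
    · rfl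
    · have h4 := tri_succ t'
      have h5 : (0+1).choose 2 = 0 := rfl
      have h6 : (t'+1+1).choose 2 = (t'+2).choose 2 := rfl
      omega
    · have h4 := tri_succ t
      have h5 : (0+1).choose 2 = 0 := rfl
      have h6 : (t+1+1).choose 2 = (t+2).choose 2 := rfl
      omega
    · rw [tri_inj h3]
  subst tt
  rcases t with _ | t
  · simp at c1
    omega
  exfalso
  obtain ⟨m, hm, im, jm⟩ := c.third hi hj
  have mi := nd_symm hi.1 hm.1 im
  have mj := nd_symm hj.1 hm.1 jm
  obtain ⟨t3, X3, G3, s3, c3, o3⟩ := c.sol1 hm (c.S1 hm)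
  have r3 := card_rem (usesSet (n+2) X ℓ) m
  have p3 := c.pos hm
  have e0 : ∀ k Q, Mx (n+2) X k → ¬ m ∣ k → ¬ k ∣ m → evalPt k Q = 0 → evalPt m Q = 0 →
      (nodesOn (usesSet (n+2) X ℓ) k).card = t + 1 + 1 →
      ((nodesOn (rem (usesSet (n+2) X ℓ) k) m).card = 0 ∨
        (nodesOn (rem (usesSet (n+2) X ℓ) k) m).card = t + 1 + 1) → Q ∉ usesSet (n+2) X ℓ := by
    intro k Q hk mk km k1 k2 k3 k4 hQ
    have y1 := cnt (U := usesSet (n+2) X ℓ) hk.1 hm.1 km k1 k2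
    have y2 := cnt (U := usesSet (n+2) X ℓ) hm.1 hk.1 mk k2 k1
    rw [if_pos hQ] at y1 y2
    have y3 := o3 k hk mk
    have y4 : t3 = t := by omega
    subst y4
    have y5 : (t3 + 1 + 2).choose 2 = (t3+2).choose 2 + (t3 + 2) := tri_succ (t3+1)
    omega
  obtain ⟨Q, hQ, Q1, Q2⟩ := P4' c.gc hi hm im
  obtain ⟨R, hR, R1, R2⟩ := P4' c.gc hj hm jm
  have a1 := e0 i Q hi mi im Q1 Q2 e2 (o1 m hm im)
  have a2 := e0 j R hj mj jm R1 R2 e1 (o2 m hm jm)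
  have z1 := cnt (U := usesSet (n+2) X ℓ) hi.1 hm.1 im Q1 Q2
  rw [if_neg a1] at z1
  have z2 := o1 m hm im
  have z3 := cnt (U := rem (usesSet (n+2) X ℓ) i) hj.1 hm.1 jm R1 R2
  rw [if_neg (fun h => a2 (rem_sub _ _ h))] at z3
  have z4 := card_rem (rem (usesSet (n+2) X ℓ) i) j
  have z5 : (t + 1 + 2).choose 2 = (t+2).choose 2 + (t + 2) := tri_succ (t+1)
  have z6 : (rem (rem (usesSet (n+2) X ℓ) i) j).card = (t+2).choose 2 := by omega
  have z7 : 0 < (t+2).choose 2 := Nat.choose_pos (by omega)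
  obtain ⟨t4, X4, G4, s4, c4, o4⟩ := c.sol2 hi hj ij (Finset.card_pos.1 (by omega))
  have z8 : t4 = t := tri_inj (by omega)
  have z9 := o4 m hm im jm
  omega

/-- all intersection points are users -/
theorem Ctx.S3 (c : Ctx N n X ℓ)
    (hall : ∀ i j P, Mx (n+2) X i → Mx (n+2) X j → ¬ i ∣ j → evalPt i P = 0 → evalPt j P = 0 →
      P ∈ usesSet (n+2) X ℓ) : False := by
  obtain ⟨i, hi⟩ := c.hN (n+2) c.hn X c.gc
  obtain ⟨j, hj, ij, _⟩ := c.third hi hi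
  obtain ⟨k, hk, ik, jk⟩ := c.third hi hj
  obtain ⟨V, hV, V1, V2⟩ := P4' c.gc hi hj ij
  rcases c.fourth hi hj hk ij ik jk with h | ⟨l, hl, il, jl, kl⟩
  · exact c.Q h (hall i j V hi hj ij V1 V2) V1 V2
  have ji := nd_symm hi.1 hj.1 ij
  have ki := nd_symm hi.1 hk.1 ik
  have li := nd_symm hi.1 hl.1 il
  have kj := nd_symm hj.1 hk.1 jk
  have lj := nd_symm hj.1 hl.1 jl
  have lk := nd_symm hk.1 hl.1 kl
  -- each maximal line has at least three users: here for the four lines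
  have M2 : ∀ x y z, Mx (n+2) X x → Mx (n+2) X y → Mx (n+2) X z → ¬ x ∣ y → ¬ x ∣ z → ¬ y ∣ z → 
      2 ≤ (nodesOn (usesSet (n+2) X ℓ) x).card := by
    intro x y z hx hy hz xy xz yz
    obtain ⟨P, hP, P1, P2⟩ := P4' c.gc hx hy xy
    obtain ⟨Q, hQ, Q1, Q2⟩ := P4' c.gc hx hz xz
    refine Finset.one_lt_card.2 ⟨P, mem_on.2 ⟨hall x y P hx hy xy P1 P2, P1⟩, Q,
      mem_on.2 ⟨hall x z Q hx hz xz Q1 Q2, Q1⟩, ?_⟩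
    rintro rfl
    exact P5 c.gc hx hy hz xy xz yz P1 P2 Q2
  have cn : ∀ x y, Mx (n+2) X x → Mx (n+2) X y → ¬ x ∣ y → 
      1 + (nodesOn (rem (usesSet (n+2) X ℓ) x) y).card = (nodesOn (usesSet (n+2) X ℓ) y).card := by
    intro x y hx hy xy
    obtain ⟨P, hP, P1, P2⟩ := P4' c.gc hx hy xy
    have := cnt (U := usesSet (n+2) X ℓ) hx.1 hy.1 xy P1 P2
    rwa [if_pos (hall x y P hx hy xy P1 P2)] at this
  obtain ⟨t, X1, G1, s1, c1, o1⟩ := c.sol1 hi (c.S1 hi)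
  obtain ⟨t', X2, G2, s2, c2, o2⟩ := c.sol1 hj (c.S1 hj)
  have tt : t = t' := by
    have a1 := o1 k hk ik
    have a2 := o2 k hk jk
    have a3 := cn i k hi hk ik
    have a4 := cn j k hj hk jk
    have := M2 k i j hk hi hj ki kj ij
    omega
  subst tt
  have a1 := o1 j hj ij
  have a3 := cn i j hi hj ij
  have a4 := M2 j i k hj hi hk ji jk ik
  have z4 := card_rem (rem (usesSet (n+2) X ℓ) i) j
  have z5 := tri_succ t
  have a5 : 1 ≤ t := by
    -- three users on j
    obtain ⟨A, hA, A1, A2⟩ := P4' c.gc hj hk jk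
    obtain ⟨B, hB, B1, B2⟩ := P4' c.gc hj hl jl
    have : 1 < (nodesOn (rem (usesSet (n+2) X ℓ) i) j).card := by
      refine Finset.one_lt_card.2 ⟨A, mem_on.2 ⟨mem_rem.2 ⟨hall j k A hj hk jk A1 A2, ?_⟩, A1⟩, B,
        mem_on.2 ⟨mem_rem.2 ⟨hall j l B hj hl jl B1 B2, ?_⟩, B1⟩, ?_⟩
      · exact P5 c.gc hj hk hi jk ji ki A1 A2
      · exact P5 c.gc hj hl hi jl ji li B1 B2
      · rintro rfl
        exact P5 c.gc hj hk hl jk jl kl A1 A2 B2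
    omega
  have z6 : (rem (rem (usesSet (n+2) X ℓ) i) j).card = (t+1).choose 2 := by omega
  have z7 : 0 < (t+1).choose 2 := Nat.choose_pos (by omega)
  obtain ⟨t4, X4, G4, s4, c4, o4⟩ := c.sol2 hi hj ij (Finset.card_pos.1 (by omega))
  have z8 : t4 + 1 = t := by
    obtain ⟨t, rfl⟩ : ∃ u, t = u + 1 := ⟨t - 1, by omega⟩
    have : t4 = t := tri_inj (by rw [← c4, z6])
    omega
  have g1 := rem_GC c.gc hi
  have g2 := rem_GC c.gc hj
  have mij := P6 c.gc hi hj ij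
  have mji := P6 c.gc hj hi ji
  -- the new line of `rem X j`
  have hnew : ∃ ν, Mx (n+1) (rem X j) ν ∧ ¬ ℓ ∣ ν ∧
      (∀ A ∈ usesSet (n+1) (rem X j) ℓ, evalPt ν A ≠ 0) ∧ ∀ P ∈ rem X j, evalPt ν P = 0 → P ∉ X2 := by
    have hr := s2.red
    have hmx := s2.mx
    generalize hN1 : n + 1 = N1 at hr ⊢
    generalize hY : rem X j = Y at hr ⊢
    cases hr with
    | base _ _ hX =>
      exfalso
      have hmx' : Mx (n+1) (rem X j) ℓ := by rw [hN1, hY]; exact hmx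
      rcases P7 c.gc hmx' with h | h
      · exact c.nm h
      · obtain ⟨P, hP, h3, h4⟩ := c.F hj
        exact h P hP h3 h4
    | step n' _ a _ _ G hX ha hla hu hr =>
      exact ⟨a, ha, hla, hu, fun P hP h3 h4 => (mem_rem.1 (hr.sub h4)).2 h3⟩
  obtain ⟨ν, hν, hlν, huν, hνX⟩ := hnew
  have huj := uses_rem c.gc hj c.hl (c.nd hj)
  -- auxiliary users: B on j,l ; A on i,l
  obtain ⟨B, hB, B1, B2⟩ := P4' c.gc hj hl jl
  obtain ⟨A, hA, A1, A2⟩ := P4' c.gc hi hl il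
  have hBu := hall j l B hj hl jl B1 B2
  have hAu := hall i l A hi hl il A1 A2
  have hBi : evalPt i B ≠ 0 := P5 c.gc hj hl hi jl ji li B1 B2
  have hAj : evalPt j A ≠ 0 := P5 c.gc hi hl hj il ij lj A1 A2
  have hAj' : A ∈ rem X j := mem_rem.2 ⟨hA, hAj⟩
  have hBi' : B ∈ rem X i := mem_rem.2 ⟨hB, hBi⟩
  have hAuj : A ∈ usesSet (n+1) (rem X j) ℓ := by rw [huj]; exact mem_rem.2 ⟨hAu, hAj⟩
  have dj : Dj X j ν := by
    refine (P7 c.gc hν).resolve_left fun h => ?_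
    have jν := not_dvd_rem hj.1 hν
    have q1 := cn j ν hj h jν
    -- two users on ν
    obtain ⟨w, hw, jw, νw⟩ := c.third hj h
    have q2 := M2 ν j w h hj hw (nd_symm hj.1 h.1 jν) νw jw
    obtain ⟨D, hD⟩ := Finset.card_pos.1 (show 0 < (nodesOn (rem (usesSet (n+2) X ℓ) j) ν).card by omega)
    rw [← huj] at hD
    exact huν D (mem_on.1 hD).1 (mem_on.1 hD).2
  have hBd := ((mem_uses c.gc).1 hBu).2
  obtain ⟨E, hE, E1, E2⟩ := D1 c.gc hj hν dj hB B1 c.hl hBd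
  obtain ⟨g, hg⟩ := hBd
  have hgE := D2 c.gc hj hν dj hB B1 c.hl hg hE E1 E2
  have hEj := (mem_rem.1 hE).2
  have hEX := (mem_rem.1 hE).1
  have hEi : evalPt i E ≠ 0 := by
    intro hEi
    obtain ⟨g', hg'⟩ := ((mem_uses g2).1 hAuj).2
    have q1 := M2x g2 mji hAj' A1 c.hl hg' hE hEi E2
    have q2 := mx_dvd_fd g2 hν hAj' (huν A hAuj)
    rw [hg'] at q2
    rcases hν.ln.prime.dvd_or_dvd q2 with q3 | q3
    · exact hlν (dvd_symm_line hν.1 c.hl q3)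
    · exact q1 (ev_dvd q3 E1)
  have hEi' : E ∈ rem X i := mem_rem.2 ⟨hEX, hEi⟩
  have hBdi := (dvd_fd_rem c.gc hi hBi' c.hl (c.nd hi)).1 ⟨g, hg⟩
  have nE : ¬ Null (n+1) (rem X i) ℓ E := by
    intro h
    obtain ⟨g', hg'⟩ := hBdi
    have q1 := h B hBi' g' hg'
    have q2 := fd_rem c.gc hi hBi'
    rw [hg, hg'] at q2
    have q3 : g = C (evalPt i B)⁻¹ * (i * g') := mul_left_cancel₀ c.hl.ne_zero (by rw [q2]; ring)
    apply hgE
    rw [q3, ev_mul, ev_mul, q1]; ring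
  obtain ⟨F, hF, F1, _, F2⟩ := M1x g1 mij hBi' B1 c.hl hBdi
  have nF : ¬ Null (n+1) (rem X i) ℓ F := by
    intro h
    obtain ⟨g', hg'⟩ := hBdi
    exact M2x g1 mij hBi' B1 c.hl hg' hF F1 F2 (h B hBi' g' hg')
  have EF : E ≠ F := by rintro rfl; exact hEj F1
  have EX1 : E ∈ nodesOn X1 ℓ := mem_on.2 ⟨(s1.nonnull hEi').2 nE, E2⟩
  have FX1 : F ∈ nodesOn X1 ℓ := mem_on.2 ⟨(s1.nonnull hF).2 nF, F2⟩
  have EX2 : Null (n+1) (rem X j) ℓ E := by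
    by_contra h
    exact hνX E hE E1 ((s2.nonnull hE).2 h)
  have sub : nodesOn X4 ℓ ⊆ ((nodesOn X1 ℓ).erase E).erase F := by
    intro P hP
    rw [mem_on] at hP
    have hP4 := s4.red.sub hP.1
    have hP1 := mem_rem.1 hP4
    have nP := (s4.nonnull hP4).1 hP.1
    rw [Finset.mem_erase, Finset.mem_erase, mem_on]
    refine ⟨?_, ?_, ?_, hP.2⟩
    · rintro rfl; exact hP1.2 F1
    · rintro rfl
      apply nP
      rw [rem_comm]
      exact EX2.rem g2 mji hEi
    · exact (s1.nonnull hP1.1).2 fun h => nP (h.rem g1 mij hP1.2)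
  have := Finset.card_le_card sub
  rw [Finset.card_erase_of_mem (Finset.mem_erase.2 ⟨EF.symm, FX1⟩), Finset.card_erase_of_mem EX1, s4.mx.2, s1.mx.2] at this
  omega
end

section
variable {N n : ℕ} {X : Finset (ℝ × ℝ)} {ℓ : Poly2}

theorem strip {a p : Poly2} (ha : Ln a) (hp : p ≠ 0) (h : a ∣ p) :
    ∃ q : Poly2, q ≠ 0 ∧ p.totalDegree = q.totalDegree + 1 ∧ ∀ b, Ln b → ¬ b ∣ a → b ∣ p → b ∣ q := by
  obtain ⟨q, rfl⟩ := h
  have hq := right_ne_zero_of_mul hp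
  refine ⟨q, hq, ?_, ?_⟩
  · rw [deg_mul_line ha hq]
  · intro b hb hba hbp
    exact (hb.prime.dvd_or_dvd hbp).resolve_left hba

theorem Ctx.new (c : Ctx N n X ℓ) {x y z w : Poly2} (hx : Mx (n+2) X x) (hy : Mx (n+2) X y)
    (hz : Mx (n+2) X z) (hw : Mx (n+2) X w) (xy : ¬ x ∣ y) (xz : ¬ x ∣ z) (xw : ¬ x ∣ w)
    (yz : ¬ y ∣ z) (yw : ¬ y ∣ w) (zw : ¬ z ∣ w)
    (hall : ∀ d, Mx (n+2) X d → x ∣ d ∨ y ∣ d ∨ z ∣ d ∨ w ∣ d) {A B : ℝ × ℝ}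
    (hA : A ∈ usesSet (n+2) X ℓ) (A1 : evalPt x A = 0) (A2 : evalPt y A = 0)
    (hB : B ∈ usesSet (n+2) X ℓ) (B1 : evalPt z B = 0) (B2 : evalPt w B = 0) :
    ∃ ν, Mx (n+1) (rem X x) ν ∧ Dj X x ν := by
  by_contra hcon
  push Not at hcon
  have g1 := rem_GC c.gc hx
  have hT : Three (n+1) (rem X x) z w y := by
    refine ⟨g1, P6 c.gc hx hz xz, P6 c.gc hx hw xw, P6 c.gc hx hy xy, zw, nd_symm hy.1 hz.1 yz,
      nd_symm hy.1 hw.1 yw, ?_⟩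
    intro d hd
    have h1 := (P7 c.gc hd).resolve_right (hcon d hd)
    have h2 := hall d h1
    have h3 := not_dvd_rem hx.1 hd
    tauto
  obtain ⟨hAX, hAd⟩ := (mem_uses c.gc).1 hA
  obtain ⟨hBX, hBd⟩ := (mem_uses c.gc).1 hB
  have hBx : B ∈ rem X x := mem_rem.2 ⟨hBX, P5 c.gc hz hw hx zw (nd_symm hx.1 hz.1 xz) (nd_symm hx.1 hw.1 xw) B1 B2⟩
  have h1 := QQ c.hN n (by have := c.hn; omega) (rem X x) z w y ℓ B hT hBx B1 B2 c.hl
    ((dvd_fd_rem c.gc hx hBx c.hl (c.nd hx)).1 hBd) (c.nd' hy)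
  obtain ⟨F, hF, F1, F2⟩ := c.F hy
  refine h1 F (mem_rem.2 ⟨hF, fun F3 => ?_⟩) F1 F2
  have : A = F := line_eq_pt hx.1 hy.1 xy A1 F3 A2 F1
  subst this
  exact fd_line_ne c.gc hAX hAd F2

theorem Ctx.L4 (c : Ctx N n X ℓ) {i m j l : Poly2} (hi : Mx (n+2) X i) (hm : Mx (n+2) X m)
    (hj : Mx (n+2) X j) (hl : Mx (n+2) X l) (im : ¬ i ∣ m) (ij : ¬ i ∣ j) (il : ¬ i ∣ l)
    (mj : ¬ m ∣ j) (ml : ¬ m ∣ l) (jl : ¬ j ∣ l)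
    (hall : ∀ d, Mx (n+2) X d → i ∣ d ∨ m ∣ d ∨ j ∣ d ∨ l ∣ d) {A B : ℝ × ℝ}
    (hA : A ∈ usesSet (n+2) X ℓ) (A1 : evalPt i A = 0) (A2 : evalPt m A = 0)
    (hB : B ∈ usesSet (n+2) X ℓ) (B1 : evalPt j B = 0) (B2 : evalPt l B = 0) : False := by
  have mi := nd_symm hi.1 hm.1 im
  have ji := nd_symm hi.1 hj.1 ij
  have li := nd_symm hi.1 hl.1 il
  have jm := nd_symm hm.1 hj.1 mj
  have lm := nd_symm hm.1 hl.1 ml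
  have lj := nd_symm hj.1 hl.1 jl
  obtain ⟨vi, hvi, di⟩ := c.new hi hm hj hl im ij il mj ml jl hall hA A1 A2 hB B1 B2
  obtain ⟨vm, hvm, dm⟩ := c.new hm hi hj hl mi mj ml ij il jl (fun d hd => by have := hall d hd; tauto)
    hA A2 A1 hB B1 B2
  obtain ⟨vj, hvj, dj⟩ := c.new hj hl hi hm jl ji jm li lm im (fun d hd => by have := hall d hd; tauto)
    hB B1 B2 hA A1 A2
  obtain ⟨vl, hvl, dl⟩ := c.new hl hj hi hm lj li lm ji jm im (fun d hd => by have := hall d hd; tauto)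
    hB B2 B1 hA A1 A2
  have hQ : Quad (n+1) X ![i, m, j, l] ![vi, vm, vj, vl] := by
    refine ⟨c.gc, ?_, ?_, ?_, ?_, ?_⟩
    · intro x; fin_cases x <;> assumption
    · intro x y hxy
      fin_cases x <;> fin_cases y <;> first | exact absurd rfl hxy | assumption
    · intro d hd
      rcases hall d hd with h | h | h | h
      · exact ⟨0, h⟩
      · exact ⟨1, h⟩
      · exact ⟨2, h⟩
      · exact ⟨3, h⟩
    · intro x; fin_cases x <;> assumption
    · intro x; fin_cases x <;> assumption
  have hL := hQ.lns
  obtain ⟨hAX, hAd⟩ := (mem_uses c.gc).1 hA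
  have Aj : evalPt j A ≠ 0 := P5 c.gc hi hm hj im ij mj A1 A2
  have Al : evalPt l A ≠ 0 := P5 c.gc hi hm hl im il ml A1 A2
  have nl : ∀ x v, Mx (n+2) X x → Dj X x v → Ln v → ¬ v ∣ ℓ := by
    intro x v hx hd hv h
    obtain ⟨F, hF, F1, F2⟩ := c.F hx
    exact hd F hF F1 ((ev_iff_of_dvd hv c.hl h F).2 F2)
  have vd : ∀ x v, Mx (n+2) X x → Mx (n+1) (rem X x) v → ¬ x ∣ i → ¬ x ∣ m → ¬ v ∣ i → ¬ v ∣ m →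
      evalPt x A ≠ 0 → v ∣ fd (n+2) X A := by
    intro x v hx hv xi xm ivi ivm hxA
    have hA' : A ∈ rem X x := mem_rem.2 ⟨hAX, hxA⟩
    have g := rem_GC c.gc hx
    have : evalPt v A ≠ 0 := P5 g (P6 c.gc hx hi xi) (P6 c.gc hx hm xm) hv im (nd_symm hv.1 hi.1 ivi)
      (nd_symm hv.1 hm.1 ivm) A1 A2
    exact (Dvd.intro_left _ rfl).trans ((mul_dvd_mul_left x (mx_dvd_fd g hv hA' this)).trans (fd_rem_dvd c.gc hx hA'))
  have e1 := vd j vj hj hvj ji jm (hL.vl 2 0) (hL.vl 2 1) Aj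
  have e2 := vd l vl hl hvl li lm (hL.vl 3 0) (hL.vl 3 1) Al
  have e3 := mx_dvd_fd c.gc hj hAX Aj
  have e4 := mx_dvd_fd c.gc hl hAX Al
  have vlvj : ¬ vl ∣ vj := hL.vv 3 2 (by decide)
  have vlj : ¬ vl ∣ j := hL.vl 3 2
  have vjl : ¬ vj ∣ l := hL.vl 2 3
  have vll : ¬ vl ∣ l := hL.vl 3 3
  have vjj : ¬ vj ∣ j := hL.vl 2 2
  have ljv := nl j vj hj dj hvj.1
  have llv := nl l vl hl dl hvl.1
  have d0 := fd_deg c.gc hAX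
  obtain ⟨q1, z1, y1, x1⟩ := strip c.hl (fd_ne c.gc hAX) hAd
  obtain ⟨q2, z2, y2, x2⟩ := strip hj.1 z1 (x1 j hj.1 (c.nd' hj) e3)
  obtain ⟨q3, z3, y3, x3⟩ := strip hl.1 z2 (x2 l hl.1 lj (x1 l hl.1 (c.nd' hl) e4))
  obtain ⟨q4, z4, y4, x4⟩ := strip hvj.1 z3 (x3 vj hvj.1 vjl (x2 vj hvj.1 vjj (x1 vj hvj.1 ljv e1)))
  obtain ⟨q5, z5, y5, x5⟩ := strip hvl.1 z4 (x4 vl hvl.1 vlvj (x3 vl hvl.1 vll (x2 vl hvl.1 vlj (x1 vl hvl.1 llv e2))))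
  obtain ⟨D, rfl⟩ : ∃ D, n = D + 3 := ⟨n - 3, by omega⟩
  exact Quad.none c.hN D (by have := c.hn; omega) X _ _ hQ

theorem Ctx.S4aux (c : Ctx N n X ℓ) {i j m : Poly2} (hi : Mx (n+2) X i) (hj : Mx (n+2) X j) (hm : Mx (n+2) X m)
    (ij : ¬ i ∣ j) (im : ¬ i ∣ m) (jm : ¬ j ∣ m) {A B : ℝ × ℝ} (hA : A ∈ usesSet (n+2) X ℓ) (hB : B ∈ usesSet (n+2) X ℓ)
    (hU : ∀ P ∈ usesSet (n+2) X ℓ, P = A ∨ P = B) (A1 : evalPt i A = 0) (B1 : evalPt j B = 0)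
    (A2 : evalPt m A = 0) : False := by
  have mi := nd_symm hi.1 hm.1 im
  have ji := nd_symm hi.1 hj.1 ij
  have mj := nd_symm hj.1 hm.1 jm
  rcases c.fourth hi hm hj im ij mj with h | ⟨l, hl, il, ml, jl⟩
  · exact c.Q h hA A1 A2
  have key : ∀ d, Mx (n+2) X d → evalPt d A = 0 ∨ evalPt d B = 0 := by
    intro d hd
    obtain ⟨P, hP, h1⟩ := c.used d hd
    rcases hU P hP with rfl | rfl
    · exact Or.inl h1
    · exact Or.inr h1
  have B2 : evalPt l B = 0 := (key l hl).resolve_left (P5 c.gc hi hm hl im il ml A1 A2)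
  refine c.L4 hi hm hj hl im ij il mj ml jl ?_ hA A1 A2 hB B1 B2
  intro d hd
  by_contra hcon
  push Not at hcon
  rcases key d hd with h | h
  · exact P5 c.gc hi hm hd im hcon.1 hcon.2.1 A1 A2 h
  · exact P5 c.gc hj hl hd jl hcon.2.2.1 hcon.2.2.2 B1 B2 h

theorem Ctx.false (c : Ctx N n X ℓ) : False := by
  by_cases hall : ∀ i j P, Mx (n+2) X i → Mx (n+2) X j → ¬ i ∣ j → evalPt i P = 0 → evalPt j P = 0 →
      P ∈ usesSet (n+2) X ℓ
  · exact c.S3 hall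
  push Not at hall
  obtain ⟨i, j, P, hi, hj, ij, h1, h2, hP⟩ := hall
  obtain ⟨u, -, -⟩ := c.S2 hi hj ij h1 h2 hP
  obtain ⟨A, hA, A1⟩ := c.used i hi
  obtain ⟨B, hB, B1⟩ := c.used j hj
  have AB : A ≠ B := by
    rintro rfl
    rw [line_eq_pt hi.1 hj.1 ij h1 A1 h2 B1] at hP
    exact hP hA
  have hU : ∀ P ∈ usesSet (n+2) X ℓ, P = A ∨ P = B := by
    have : ({A, B} : Finset (ℝ × ℝ)) = usesSet (n+2) X ℓ := by
      apply Finset.eq_of_subset_of_card_le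
      · intro Q hQ
        simp only [Finset.mem_insert, Finset.mem_singleton] at hQ
        rcases hQ with rfl | rfl <;> assumption
      · rw [u, Finset.card_pair AB]
    intro P hP
    rw [← this] at hP
    simpa using hP
  obtain ⟨m, hm, im, jm⟩ := c.third hi hj
  obtain ⟨D, hD, D1⟩ := c.used m hm
  rcases hU D hD with rfl | rfl
  · exact c.S4aux hi hj hm ij im jm hA hB hU A1 B1 D1
  · exact c.S4aux hj hi hm (nd_symm hi.1 hj.1 ij) jm im hB hA (fun P hP => (hU P hP).symm) B1 A1 D1
end

/-- structure theorem for the set of nodes using a line -/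
theorem T1 {N : ℕ} (hN : GMU N) {ℓ : Poly2} (hl : Ln ℓ) : ∀ n ≤ N, ∀ X, IsGC n X → (usesSet n X ℓ).Nonempty →
    ∃ m X' G, Sol ℓ n X m X' G := by
  intro n
  induction n using Nat.strong_induction_on with
  | _ n ih =>
    intro hn X hX hne
    obtain ⟨A, hA⟩ := hne
    have hA' := (mem_uses hX).1 hA
    match n, ih, hn, hX, hA, hA' with
    | 0, ih, hn, hX, hA, hA' => exact (deg_zero_line hX hA'.1 hl hA'.2).elim
    | k+1, ih, hn, hX, hA, hA' =>
      by_cases hm : Mx (k+1) X ℓ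
      · exact ⟨k, X, 1, hl, Red.base _ _ hX, hm⟩
      by_cases hu : ∀ a, Mx (k+1) X a → ∃ A ∈ usesSet (k+1) X ℓ, evalPt a A = 0
      · exfalso
        match k, ih, hn, hX, hA, hA', hm, hu with
        | 0, ih, hn, hX, hA, hA', hm, hu =>
          apply hm
          refine ⟨hl, le_antisymm (line_bound hX hl) ?_⟩
          obtain ⟨c, hc, h1⟩ := fd_one hX hA'.1 hl hA'.2
          have h2 : X.erase A ⊆ nodesOn X ℓ := by
            intro P hP
            rw [Finset.mem_erase] at hP
            have := fd_other hX hA'.1 hP.2 hP.1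
            rw [h1, ev_mul, ev_C] at this
            exact mem_on.2 ⟨hP.2, (mul_eq_zero.1 this).resolve_left hc⟩
          have h3 := Finset.card_le_card h2
          rw [Finset.card_erase_of_mem hA'.1, hX.1.1] at h3
          exact h3
        | k+1, ih, hn, hX, hA, hA', hm, hu =>
          exact Ctx.false (N := N) (n := k) (X := X) (ℓ := ℓ) ⟨hN, hn, hX, hl, hm, hu,
            fun m hm Y hY hne => ih m (by omega) (by omega) Y hY hne⟩
      · push Not at hu
        obtain ⟨a, ha, hua⟩ := hu
        have hla : ¬ ℓ ∣ a := fun h => hm (Mx_dvd ha hl (dvd_symm_line hl ha.1 h))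
        obtain ⟨m, X', G, h⟩ := ih k (by omega) (by omega) (rem X a) (rem_GC hX ha)
          ⟨A, by rw [uses_rem hX ha hl hla]; exact mem_rem.2 ⟨hA, hua A hA⟩⟩
        exact ⟨m, X', a * G, hl, Red.step _ _ _ _ _ _ hX ha hla hua h.red, h.mx⟩


theorem sq_dvd {N n m : ℕ} (hN : GMU N) (hn : n ≤ N) {X X' : Finset (ℝ × ℝ)} {ℓ G : Poly2}
    (h : Sol ℓ n X m X' G) {F : ℝ × ℝ} (hF : F ∈ X) (hlF : evalPt ℓ F = 0) (hF' : F ∉ X') :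
    (Polynomial.X - Polynomial.C (par ℓ F)) ^ 2 ∣ sg ℓ G := by
  have hnull : Null n X ℓ F := by
    by_contra h1
    exact hF' ((h.nonnull hF).2 h1)
  have key : ∀ A ∈ rem X' ℓ, (Polynomial.X - Polynomial.C (par ℓ F)) ^ 2 ∣ sg ℓ G * sg ℓ (fd m (rem X' ℓ) A) := by
    intro A hA
    obtain ⟨c, hc, h1⟩ := h.fd hA
    obtain ⟨u, v, hu, hv, u1, v1, h2⟩ := T4 hN n hn X ℓ F h.red.gc h.hl hF hlF hnull A
      (h.red.sub (rem_sub _ _ hA)) ⟨_, h1⟩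
    rw [h1] at h2
    have h3 := (C_dvd hc).1 ((mul_dvd_mul_iff_left h.hl.ne_zero).1 h2)
    have h4 := map_dvd (sg ℓ) h3
    rw [map_mul, map_mul] at h4
    have lin : ∀ w, evalPt w F = 0 → (Polynomial.X - Polynomial.C (par ℓ F)) ∣ sg ℓ w := by
      intro w hw
      rw [Polynomial.dvd_iff_isRoot, Polynomial.IsRoot, sg_eval, ptl_par h.hl hlF, hw]
    rw [sq]
    exact (mul_dvd_mul (lin u u1) (lin v v1)).trans h4
  have h5 := Finset.dvd_sum key
  rw [← Finset.mul_sum, ← map_sum, ← sum_fd (rem_GC h.red.gc' h.mx), map_one, mul_one] at h5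
  exact h5

theorem bound {N n m : ℕ} (hN : GMU N) (hn : n ≤ N) {X X' : Finset (ℝ × ℝ)} {ℓ G : Poly2}
    (h : Sol ℓ n X m X' G) :
    m + 2 ≤ (nodesOn X ℓ).card ∧ 2 * (nodesOn X ℓ).card ≤ n + m + 3 := by
  classical
  have hsub : nodesOn X' ℓ ⊆ nodesOn X ℓ := by
    intro P hP
    rw [mem_on] at hP ⊢
    exact ⟨h.red.sub hP.1, hP.2⟩
  have hc : (nodesOn X' ℓ).card = m + 2 := h.mx.2
  have h1 := Finset.card_le_card hsub
  refine ⟨by omega, ?_⟩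
  have h2 := Finset.card_sdiff_of_subset hsub
  have hmem : ∀ F ∈ nodesOn X ℓ \ nodesOn X' ℓ, F ∈ X ∧ evalPt ℓ F = 0 ∧ F ∉ X' := by
    intro F hF
    rw [Finset.mem_sdiff, mem_on, mem_on] at hF
    exact ⟨hF.1.1, hF.1.2, fun h => hF.2 ⟨h, hF.1.2⟩⟩
  have hg0 : sg ℓ G ≠ 0 := fun h0 => h.red.nd h.hl ((sg_eq_zero h.hl).1 h0)
  have hd : ∏ F ∈ nodesOn X ℓ \ nodesOn X' ℓ, (Polynomial.X - Polynomial.C (par ℓ F)) ^ 2 ∣ sg ℓ G := by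
    apply Finset.prod_dvd_of_coprime
    · intro F hF F' hF' hne
      apply IsCoprime.pow
      apply Polynomial.isCoprime_X_sub_C_of_isUnit_sub
      rw [isUnit_iff_ne_zero, sub_ne_zero]
      intro he
      apply hne
      rw [← ptl_par h.hl (hmem F hF).2.1, ← ptl_par h.hl (hmem F' hF').2.1, he]
    · intro F hF
      obtain ⟨a, b, d⟩ := hmem F hF
      exact sq_dvd hN hn h a b d
  have h3 := Polynomial.natDegree_le_of_dvd hd hg0
  rw [Polynomial.natDegree_prod_of_monic _ _ (fun F _ => (Polynomial.monic_X_sub_C _).pow 2)] at h3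
  simp only [Polynomial.natDegree_pow, Polynomial.natDegree_X_sub_C, mul_one, Finset.sum_const, smul_eq_mul] at h3
  have h4 := sg_natDegree ℓ G
  have h5 := h.red.deg
  omega

/-- Assuming GM up to degree `n`, for a `GC_n` set `X` and a `k`-node line `ℓ`
with `2 ≤ k ≤ n+1` and `X_ℓ ≠ ∅`, there is `s` with `2k - n - 1 ≤ s ≤ k` such that
`|X_ℓ| = (s choose 2)` and every maximal line of `X` contains either `0` or `s - 1`
nodes of `X_ℓ`. -/
theorem stmt_2 (n k : ℕ) (hGM : ∀ m ≤ n, GM m)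
    (X : Finset (ℝ × ℝ)) (hX : IsGC n X)
    (ℓ : Poly2) (hk2 : 2 ≤ k) (hkn : k ≤ n + 1) (hℓ : IsKNodeLine X ℓ k)
    (hne : usesSet n X ℓ ≠ ∅) :
    ∃ s : ℕ, (2 * k : ℤ) - n - 1 ≤ (s : ℤ) ∧ s ≤ k ∧
      (usesSet n X ℓ).card = s.choose 2 ∧
      ∀ lam : Poly2, IsMaximalLine n X lam →
        (nodesOn (usesSet n X ℓ) lam).card = 0 ∨
          (nodesOn (usesSet n X ℓ) lam).card = s - 1 := by
  obtain ⟨m, X', G, h⟩ := T1 hGM hℓ.1 n le_rfl X hX (Finset.nonempty_iff_ne_empty.2 hne)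
  obtain ⟨h1, h2⟩ := bound hGM le_rfl h
  rw [hℓ.2] at h1 h2
  refine ⟨m + 2, by push_cast; omega, h1, h.card, ?_⟩
  intro lam hlam
  exact h.on hlam
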